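/- arXiv:2211.02758 — 3 statements merged into one kernel-verified Lean document; each statement's English description precedes it below -/
import Mathlib

section
/- Convergence of hierarchies: Assume the N-hierarchy operators C^N_{s,s+k} satisfy the growth condition with constants R_0,…,R_m (uniformly in N) and the infinite-hierarchy operators C^∞_{s,s+k} satisfy the growth condition with constants ρ_0,…,ρ_m. Let T < m^{-1}·min{(Σ_{k=0}^m R_k e^k)^{-1}, (Σ_{k=0}^m ρ_k e^k)^{-1}}. For each N let 𝐅_N ∈ 𝐗_μ̄ be a mild solution of the N-hierarchy with initial datum F_{N,0} ∈ X_0, and let 𝐅 ∈ 𝐗_μ̄ be a mild solution of the infinite hierarchy with initial datum F_0 ∈ X_0. If (A1) F_{N,0} →pw F_0, (A2) sup_{N≥1} ‖F_{N,0}‖_0 < ∞, and (A3) the operators 𝐂^N converge to 𝐂^∞ (meaning: G_N →pw G implies 𝐂^N G_N →pw 𝐂^∞ G), then 𝐅_N converges in observables to 𝐅. -/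
open MeasureTheory Filter Finset

/-- The hierarchy operator `𝐂 : X → X`, `(𝐂F)^(s) := Σ_{k=0}^m C_{s,s+k} f^(s+k)`. -/
noncomputable def hierSum {X : ℕ → Type*} [∀ s, NormedAddCommGroup (X s)]
    [∀ s, NormedSpace ℝ (X s)]
    (m : ℕ) (C : ∀ s k : ℕ, X (s + k) →L[ℝ] X s) (F : ∀ s, X s) : ∀ s, X s :=
  fun s => ∑ k ∈ Finset.range (m + 1), C s k (F (s + k))

/-- `F` is a mild solution on `[0,T]` of the hierarchy `∂_t f^(s) = Σ_{k=0}^m C_{s,s+k} f^(s+k)`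
with initial datum `F₀`. -/
noncomputable def IsMildSolution {X : ℕ → Type*} [∀ s, NormedAddCommGroup (X s)]
    [∀ s, NormedSpace ℝ (X s)]
    (m : ℕ) (C : ∀ s k : ℕ, X (s + k) →L[ℝ] X s) (T : ℝ) (F₀ : ∀ s, X s)
    (F : ℝ → ∀ s, X s) : Prop :=
  (∀ s : ℕ, ∀ t ∈ Set.Icc (0 : ℝ) T,
      IntegrableOn (fun τ => hierSum m C (F τ) s) (Set.Icc 0 t) volume) ∧
  ∀ t ∈ Set.Icc (0 : ℝ) T, ∀ s : ℕ,
      F t s = F₀ s + ∫ τ in Set.Icc (0 : ℝ) t, hierSum m C (F τ) s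

/-- `F ∈ 𝐗_μ̄`: the time-dependent sequence is uniformly bounded with the weight
`μ̄(t) = −t/T`. -/
def MemXmuBar {X : ℕ → Type*} [∀ s, NormedAddCommGroup (X s)] (T : ℝ)
    (F : ℝ → ∀ s, X s) : Prop :=
  ∃ B : ℝ, ∀ t ∈ Set.Icc (0 : ℝ) T, ∀ s : ℕ, Real.exp ((-t / T) * s) * ‖F t s‖ ≤ B

/-- Pointwise weak convergence of sequences in `X = ⊕_s X^(s)`. -/
def PWConv {X : ℕ → Type*} [∀ s, NormedAddCommGroup (X s)] [∀ s, NormedSpace ℝ (X s)]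
    (FN : ℕ → ∀ s, X s) (F : ∀ s, X s) : Prop :=
  ∀ s : ℕ, ∀ φ : X s →L[ℝ] ℝ,
    Tendsto (fun N => φ (FN N s)) atTop (nhds (φ (F s)))

theorem MemXmuBar.exists_norm_le {X : ℕ → Type*} [∀ s, NormedAddCommGroup (X s)] {T : ℝ}
    {F : ℝ → ∀ s, X s} (hF : MemXmuBar T F) :
    ∃ K : ℝ, ∀ t ∈ Set.Icc (0 : ℝ) T, ∀ s : ℕ, ‖F t s‖ ≤ K * Real.exp (t / T * s) := by
  obtain ⟨K, hK⟩ := hF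
  refine ⟨K, fun t ht s => ?_⟩
  have h := mul_le_mul_of_nonneg_right (hK t ht s) (Real.exp_nonneg (t / T * s))
  have he : Real.exp (-t / T * s) * Real.exp (t / T * s) = 1 := by
    rw [← Real.exp_add, ← Real.exp_zero]
    congr 1
    ring
  calc ‖F t s‖ = Real.exp (-t / T * s) * Real.exp (t / T * s) * ‖F t s‖ := by rw [he, one_mul]
    _ = Real.exp (-t / T * s) * ‖F t s‖ * Real.exp (t / T * s) := by ring
    _ ≤ _ := h

section HierarchyEstimates

variable {X : ℕ → Type*} [∀ s, NormedAddCommGroup (X s)] [∀ s, NormedSpace ℝ (X s)]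

theorem hierSum_sub (m : ℕ) (C : ∀ s k : ℕ, X (s + k) →L[ℝ] X s) (F G : ∀ s, X s) (s : ℕ) :
    hierSum m C (F - G) s = hierSum m C F s - hierSum m C G s := by
  simp [hierSum, Finset.sum_sub_distrib]

theorem hierSum_sum_smul (m : ℕ) (C : ∀ s k : ℕ, X (s + k) →L[ℝ] X s) {ι : Type*}
    (I : Finset ι) (a : ι → ℝ) (F : ι → ∀ s, X s) (s : ℕ) :
    hierSum m C (fun s => ∑ j ∈ I, a j • F j s) s = ∑ j ∈ I, a j • hierSum m C (F j) s := by
  simp only [hierSum, map_sum, map_smul, Finset.smul_sum]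
  exact Finset.sum_comm

/-- The integral operator of the hierarchy is bounded on `𝐗_μ̄` by `T * Σ_k R_k e^k`. -/
theorem norm_integral_hierSum_le {m : ℕ} {C : ∀ s k : ℕ, X (s + k) →L[ℝ] X s} {R : ℕ → ℝ}
    (hR : ∀ k, 0 ≤ R k)
    (hC : ∀ s : ℕ, ∀ k ≤ m, ∀ f : X (s + k), ‖C s k f‖ ≤ R k * s * ‖f‖)
    {T : ℝ} (hT : 0 < T) {G : ℝ → ∀ s, X s} {K : ℝ}
    (hG : ∀ t ∈ Set.Icc (0 : ℝ) T, ∀ s : ℕ, ‖G t s‖ ≤ K * Real.exp (t / T * s))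
    {t : ℝ} (ht : t ∈ Set.Icc (0 : ℝ) T) (s : ℕ) :
    ‖∫ τ in Set.Icc (0 : ℝ) t, hierSum m C (G τ) s‖ ≤
      T * (∑ k ∈ Finset.range (m + 1), R k * Real.exp k) * K * Real.exp (t / T * s) := by
  set A := ∑ k ∈ Finset.range (m + 1), R k * Real.exp k with hA
  have hA0 : 0 ≤ A := Finset.sum_nonneg fun k _ => mul_nonneg (hR k) (Real.exp_nonneg _)
  have hK : 0 ≤ K := by
    have := (norm_nonneg _).trans (hG 0 ⟨le_rfl, hT.le⟩ 0)
    simpa using this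
  have hpt : ∀ τ ∈ Set.Icc (0 : ℝ) t,
      ‖hierSum m C (G τ) s‖ ≤ A * K * (s * Real.exp (τ / T * s)) := by
    intro τ hτ
    have hτT : τ ∈ Set.Icc (0 : ℝ) T := ⟨hτ.1, hτ.2.trans ht.2⟩
    have hτ1 : τ / T ≤ 1 := (div_le_one hT).2 hτT.2
    rw [hA, Finset.sum_mul, Finset.sum_mul]
    refine norm_sum_le_of_le _ fun k hk => ?_
    refine (hC s k (Nat.lt_succ_iff.1 (Finset.mem_range.1 hk)) _).trans ?_
    have hexp : Real.exp (τ / T * ((s + k : ℕ) : ℝ)) ≤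
        Real.exp k * Real.exp (τ / T * s) := by
      rw [← Real.exp_add]
      apply Real.exp_le_exp.2
      push_cast
      nlinarith [mul_le_mul_of_nonneg_right hτ1 (Nat.cast_nonneg (α := ℝ) k)]
    calc R k * s * ‖G τ (s + k)‖
        ≤ R k * s * (K * (Real.exp k * Real.exp (τ / T * s))) := by
          refine mul_le_mul_of_nonneg_left ?_ (mul_nonneg (hR k) (Nat.cast_nonneg s))
          exact (hG τ hτT _).trans (mul_le_mul_of_nonneg_left hexp hK)
      _ = R k * Real.exp k * K * (s * Real.exp (τ / T * s)) := by ring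
  have hcont : Continuous fun τ : ℝ => A * K * (s * Real.exp (τ / T * s)) := by fun_prop
  have hint : ∫ τ in Set.Icc (0 : ℝ) t, (s : ℝ) * Real.exp (τ / T * s) =
      T * Real.exp (t / T * s) - T := by
    rw [integral_Icc_eq_integral_Ioc, ← intervalIntegral.integral_of_le ht.1]
    have hd : ∀ x ∈ Set.uIcc (0 : ℝ) t,
        HasDerivAt (fun τ : ℝ => T * Real.exp (τ / T * s)) (s * Real.exp (x / T * s)) x := by
      intro x _
      have := ((((hasDerivAt_id x).div_const T).mul_const (s : ℝ)).exp).const_mul T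
      refine this.congr_deriv ?_
      simp only [id]
      field_simp
    rw [intervalIntegral.integral_eq_sub_of_hasDerivAt hd
      (Continuous.intervalIntegrable (by fun_prop) _ _)]
    simp
  calc ‖∫ τ in Set.Icc (0 : ℝ) t, hierSum m C (G τ) s‖
      ≤ ∫ τ in Set.Icc (0 : ℝ) t, A * K * (s * Real.exp (τ / T * s)) :=
        norm_integral_le_of_norm_le hcont.continuousOn.integrableOn_Icc
          ((ae_restrict_iff' measurableSet_Icc).2 (Eventually.of_forall hpt))
    _ = A * K * (T * Real.exp (t / T * s) - T) := by rw [integral_const_mul, hint]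
    _ ≤ T * A * K * Real.exp (t / T * s) := by
        nlinarith [mul_nonneg (mul_nonneg hA0 hK) hT.le]

/-- A priori bound on mild solutions in terms of the initial datum only. -/
theorem IsMildSolution.norm_le {m : ℕ} {C : ∀ s k : ℕ, X (s + k) →L[ℝ] X s} {R : ℕ → ℝ}
    (hR : ∀ k, 0 ≤ R k)
    (hC : ∀ s : ℕ, ∀ k ≤ m, ∀ f : X (s + k), ‖C s k f‖ ≤ R k * s * ‖f‖)
    {T : ℝ} (hT : 0 < T) (hθ : T * (∑ k ∈ Finset.range (m + 1), R k * Real.exp k) < 1)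
    {F₀ : ∀ s, X s} {F : ℝ → ∀ s, X s} (hF : IsMildSolution m C T F₀ F) (hmem : MemXmuBar T F)
    {B : ℝ} (hB : ∀ s, ‖F₀ s‖ ≤ B) {t : ℝ} (ht : t ∈ Set.Icc (0 : ℝ) T) (s : ℕ) :
    ‖F t s‖ ≤ B / (1 - T * ∑ k ∈ Finset.range (m + 1), R k * Real.exp k) *
      Real.exp (t / T * s) := by
  obtain ⟨K, hK⟩ := hmem.exists_norm_le
  have hθ0 : 0 ≤ T * (∑ k ∈ Finset.range (m + 1), R k * Real.exp k) :=
    mul_nonneg hT.le (Finset.sum_nonneg fun k _ => mul_nonneg (hR k) (Real.exp_nonneg _))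
  have hbound := fun (K : ℝ) hG (t : ℝ) ht s =>
    norm_integral_hierSum_le (G := F) (K := K) (t := t) hR hC hT hG ht s
  generalize T * (∑ k ∈ Finset.range (m + 1), R k * Real.exp k) = θ at *
  have hB0 : 0 ≤ B := (norm_nonneg _).trans (hB 0)
  have h1 : 0 < 1 - θ := by linarith
  have hiter : ∀ n : ℕ, ∀ t ∈ Set.Icc (0 : ℝ) T, ∀ s : ℕ,
      ‖F t s‖ ≤ (B / (1 - θ) + θ ^ n * K) * Real.exp (t / T * s) := by
    intro n
    induction n with
    | zero =>
      intro t ht s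
      refine (hK t ht s).trans (mul_le_mul_of_nonneg_right ?_ (Real.exp_nonneg _))
      have := div_nonneg hB0 h1.le
      simpa using this
    | succ n ih =>
      intro t ht s
      rw [hF.2 t ht s]
      have hexp : 1 ≤ Real.exp (t / T * s) :=
        Real.one_le_exp (mul_nonneg (div_nonneg ht.1 hT.le) (Nat.cast_nonneg s))
      calc ‖F₀ s + ∫ τ in Set.Icc (0 : ℝ) t, hierSum m C (F τ) s‖
          ≤ B * Real.exp (t / T * s) +
              θ * (B / (1 - θ) + θ ^ n * K) * Real.exp (t / T * s) :=
            norm_add_le_of_le ((hB s).trans (le_mul_of_one_le_right hB0 hexp))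
              (hbound _ ih t ht s)
        _ = (B / (1 - θ) + θ ^ (n + 1) * K) * Real.exp (t / T * s) := by
            field_simp
            ring
  have hlim : Tendsto (fun n : ℕ => (B / (1 - θ) + θ ^ n * K) * Real.exp (t / T * s)) atTop
      (nhds ((B / (1 - θ) + 0 * K) * Real.exp (t / T * s))) :=
    (((tendsto_pow_atTop_nhds_zero_of_lt_one hθ0 hθ).mul_const K).const_add _).mul_const _
  rw [zero_mul, add_zero] at hlim
  exact ge_of_tendsto' hlim fun n => hiter n t ht s

/-- The Taylor polynomial `Σ_{j<n} t^j/j! 𝐂^j F₀` of the hierarchy flow. -/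
noncomputable def hierTaylor (m : ℕ) (C : ∀ s k : ℕ, X (s + k) →L[ℝ] X s) (F₀ : ∀ s, X s)
    (n : ℕ) (t : ℝ) : ∀ s, X s :=
  fun s => ∑ j ∈ Finset.range n, (t ^ j / (j.factorial : ℝ)) • (hierSum m C)^[j] F₀ s

theorem hierSum_hierTaylor (m : ℕ) (C : ∀ s k : ℕ, X (s + k) →L[ℝ] X s) (F₀ : ∀ s, X s)
    (n : ℕ) (t : ℝ) (s : ℕ) :
    hierSum m C (hierTaylor m C F₀ n t) s =
      ∑ j ∈ Finset.range n, (t ^ j / (j.factorial : ℝ)) • (hierSum m C)^[j + 1] F₀ s := by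
  simp only [Function.iterate_succ_apply']
  exact hierSum_sum_smul m C _ _ _ s

theorem integrableOn_hierSum_hierTaylor (m : ℕ) (C : ∀ s k : ℕ, X (s + k) →L[ℝ] X s)
    (F₀ : ∀ s, X s) (n : ℕ) (t : ℝ) (s : ℕ) :
    IntegrableOn (fun τ => hierSum m C (hierTaylor m C F₀ n τ) s) (Set.Icc 0 t) volume := by
  simp only [hierSum_hierTaylor]
  exact Continuous.integrableOn_Icc (by fun_prop)

variable [∀ s, CompleteSpace (X s)]

theorem hierTaylor_succ (m : ℕ) (C : ∀ s k : ℕ, X (s + k) →L[ℝ] X s) (F₀ : ∀ s, X s)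
    (n : ℕ) {t : ℝ} (ht : 0 ≤ t) (s : ℕ) :
    hierTaylor m C F₀ (n + 1) t s =
      F₀ s + ∫ τ in Set.Icc (0 : ℝ) t, hierSum m C (hierTaylor m C F₀ n τ) s := by
  have hint : ∀ j : ℕ, ∫ τ in Set.Icc (0 : ℝ) t, τ ^ j / (j.factorial : ℝ) =
      t ^ (j + 1) / ((j + 1).factorial : ℝ) := by
    intro j
    rw [integral_Icc_eq_integral_Ioc, ← intervalIntegral.integral_of_le ht,
      intervalIntegral.integral_div, integral_pow, Nat.factorial_succ]
    push_cast
    have : (j.factorial : ℝ) ≠ 0 := by positivity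
    field_simp
    simp
  simp only [hierSum_hierTaylor]
  rw [integral_finsetSum _ fun j _ => Continuous.integrableOn_Icc (by fun_prop)]
  simp only [integral_smul_const, hint]
  rw [hierTaylor, Finset.sum_range_succ', add_comm]
  simp

/-- Remainder estimate for the Taylor expansion of a mild solution. -/
theorem IsMildSolution.norm_sub_hierTaylor_le {m : ℕ} {C : ∀ s k : ℕ, X (s + k) →L[ℝ] X s}
    {R : ℕ → ℝ} (hR : ∀ k, 0 ≤ R k)
    (hC : ∀ s : ℕ, ∀ k ≤ m, ∀ f : X (s + k), ‖C s k f‖ ≤ R k * s * ‖f‖)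
    {T : ℝ} (hT : 0 < T) {F₀ : ∀ s, X s} {F : ℝ → ∀ s, X s} (hF : IsMildSolution m C T F₀ F)
    {K : ℝ} (hK : ∀ t ∈ Set.Icc (0 : ℝ) T, ∀ s : ℕ, ‖F t s‖ ≤ K * Real.exp (t / T * s))
    (n : ℕ) : ∀ t ∈ Set.Icc (0 : ℝ) T, ∀ s : ℕ,
      ‖(F t - hierTaylor m C F₀ n t) s‖ ≤
        (T * ∑ k ∈ Finset.range (m + 1), R k * Real.exp k) ^ n * K * Real.exp (t / T * s) := by
  induction n with
  | zero =>
    intro t ht s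
    simpa [hierTaylor] using hK t ht s
  | succ n ih =>
    intro t ht s
    have heq : (F t - hierTaylor m C F₀ (n + 1) t) s =
        ∫ τ in Set.Icc (0 : ℝ) t, hierSum m C (F τ - hierTaylor m C F₀ n τ) s := by
      simp only [hierSum_sub]
      rw [integral_sub (hF.1 s t ht) (integrableOn_hierSum_hierTaylor m C F₀ n t s),
        Pi.sub_apply, hF.2 t ht s, hierTaylor_succ m C F₀ n ht.1 s]
      abel
    rw [heq]
    refine (norm_integral_hierSum_le hR hC hT ih ht s).trans_eq ?_
    ring

end HierarchyEstimates

theorem PWConv.iterate {X : ℕ → Type*} [∀ s, NormedAddCommGroup (X s)]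
    [∀ s, NormedSpace ℝ (X s)] {AN : ℕ → (∀ s, X s) → ∀ s, X s} {A : (∀ s, X s) → ∀ s, X s}
    (hA : ∀ (GN : ℕ → ∀ s, X s) (G : ∀ s, X s), PWConv GN G →
      PWConv (fun N => AN N (GN N)) (A G))
    {GN : ℕ → ∀ s, X s} {G : ∀ s, X s} (hG : PWConv GN G) (j : ℕ) :
    PWConv (fun N => (AN N)^[j] (GN N)) (A^[j] G) := by
  induction j with
  | zero => exact hG
  | succ j ih =>
    simp only [Function.iterate_succ_apply']
    exact hA _ _ ih

/-- Pointwise weak convergence of all `𝐂^j F₀` makes the Taylor polynomials converge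
in observables. -/
theorem tendstoUniformlyOn_hierTaylor {X : ℕ → Type*} [∀ s, NormedAddCommGroup (X s)]
    [∀ s, NormedSpace ℝ (X s)] {m : ℕ} {CN : ℕ → ∀ s k : ℕ, X (s + k) →L[ℝ] X s}
    {C : ∀ s k : ℕ, X (s + k) →L[ℝ] X s} {FN0 : ℕ → ∀ s, X s} {F0 : ∀ s, X s}
    (h : ∀ j, PWConv (fun N => (hierSum m (CN N))^[j] (FN0 N)) ((hierSum m C)^[j] F0))
    (T : ℝ) (n s : ℕ) (φ : X s →L[ℝ] ℝ) :
    TendstoUniformlyOn (fun N t => φ (hierTaylor m (CN N) (FN0 N) n t s))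
      (fun t => φ (hierTaylor m C F0 n t s)) atTop (Set.Icc 0 T) := by
  have hlim : Tendsto (fun N => ∑ j ∈ Finset.range n, T ^ j / (j.factorial : ℝ) *
      |φ ((hierSum m C)^[j] F0 s) - φ ((hierSum m (CN N))^[j] (FN0 N) s)|) atTop (nhds 0) := by
    have := tendsto_finsetSum (Finset.range n) fun j _ =>
      (((h j s φ).const_sub (φ ((hierSum m C)^[j] F0 s))).abs).const_mul
        (T ^ j / (j.factorial : ℝ))
    simpa using this
  rw [Metric.tendstoUniformlyOn_iff]
  intro ε hε
  filter_upwards [hlim.eventually_lt_const hε] with N hN t ht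
  refine lt_of_le_of_lt ?_ hN
  rw [Real.dist_eq]
  simp only [hierTaylor, map_sum, map_smul, smul_eq_mul, ← Finset.sum_sub_distrib, ← mul_sub]
  refine (Finset.abs_sum_le_sum_abs _ _).trans (Finset.sum_le_sum fun j _ => ?_)
  have h0 : 0 ≤ t ^ j / (j.factorial : ℝ) := div_nonneg (pow_nonneg ht.1 j) (Nat.cast_nonneg _)
  rw [abs_mul, abs_of_nonneg h0]
  have := pow_le_pow_left₀ ht.1 ht.2 j
  gcongr

theorem mul_lt_one_of_lt_inv_mul_min {m : ℕ} {T a b : ℝ} (hT : 0 < T) (ha : 0 ≤ a) (hb : 0 ≤ b)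
    (h : T < (m : ℝ)⁻¹ * min a⁻¹ b⁻¹) : T * a < 1 ∧ T * b < 1 := by
  have hle : (m : ℝ)⁻¹ ≤ 1 := Nat.cast_inv_le_one m
  have hmin : T < min a⁻¹ b⁻¹ :=
    h.trans_le (mul_le_of_le_one_left (le_min (inv_nonneg.2 ha) (inv_nonneg.2 hb)) hle)
  have hlt : ∀ {c : ℝ}, T < c⁻¹ → T * c < 1 := by
    intro c hTc
    rw [← lt_div_iff₀ (inv_pos.1 (hT.trans hTc)), one_div]
    exact hTc
  obtain ⟨h1, h2⟩ := lt_min_iff.1 hmin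
  exact ⟨hlt h1, hlt h2⟩

/-- **Convergence of hierarchies** (Theorem 2.1 of the paper). Under uniform growth conditions
on the `N`-hierarchy operators and the infinite-hierarchy operators, for
`T < m⁻¹·min{(Σ R_k e^k)⁻¹, (Σ ρ_k e^k)⁻¹}`, if the initial data converge pointwise weakly and
are uniformly bounded, and the operators `𝐂^N` converge to `𝐂^∞`, then the mild solutions
`𝐅_N` of the `N`-hierarchies converge in observables to the mild solution `𝐅` of the
infinite hierarchy. -/
theorem stmt1 {X : ℕ → Type*} [∀ s, NormedAddCommGroup (X s)] [∀ s, NormedSpace ℝ (X s)]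
    [∀ s, CompleteSpace (X s)]
    (m : ℕ)
    (CN : ℕ → ∀ s k : ℕ, X (s + k) →L[ℝ] X s)
    (Cinf : ∀ s k : ℕ, X (s + k) →L[ℝ] X s)
    (R ρ : ℕ → ℝ) (hR : ∀ k, 0 ≤ R k) (hρ : ∀ k, 0 ≤ ρ k)
    (hgrowN : ∀ N : ℕ, ∀ s : ℕ, ∀ k ≤ m, ∀ f : X (s + k), ‖CN N s k f‖ ≤ R k * s * ‖f‖)
    (hgrowInf : ∀ s : ℕ, ∀ k ≤ m, ∀ f : X (s + k), ‖Cinf s k f‖ ≤ ρ k * s * ‖f‖)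
    (T : ℝ) (hT0 : 0 < T)
    (hT : T < (m : ℝ)⁻¹ * min (∑ k ∈ Finset.range (m + 1), R k * Real.exp k)⁻¹
        (∑ k ∈ Finset.range (m + 1), ρ k * Real.exp k)⁻¹)
    (FN0 : ℕ → ∀ s, X s) (F0 : ∀ s, X s)
    (FN : ℕ → ℝ → ∀ s, X s) (F : ℝ → ∀ s, X s)
    (hFN : ∀ N, MemXmuBar T (FN N) ∧ IsMildSolution m (CN N) T (FN0 N) (FN N))
    (hF : MemXmuBar T F ∧ IsMildSolution m Cinf T F0 F)
    -- (A1) pointwise weak convergence of the initial data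
    (hA1 : PWConv FN0 F0)
    -- (A2) uniform bound on the initial data
    (hA2 : ∃ B : ℝ, ∀ N : ℕ, ∀ s : ℕ, ‖FN0 N s‖ ≤ B)
    -- (A3) convergence of the hierarchy operators
    (hA3 : ∀ (GN : ℕ → ∀ s, X s) (G : ∀ s, X s), PWConv GN G →
        PWConv (fun N => hierSum m (CN N) (GN N)) (hierSum m Cinf G)) :
    -- `𝐅_N` converges in observables to `𝐅`
    ∀ s : ℕ, ∀ φ : X s →L[ℝ] ℝ,
      TendstoUniformlyOn (fun N t => φ (FN N t s)) (fun t => φ (F t s)) atTop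
        (Set.Icc 0 T) := by
  have hsum : ∀ {r : ℕ → ℝ}, (∀ k, 0 ≤ r k) →
      0 ≤ ∑ k ∈ Finset.range (m + 1), r k * Real.exp k := fun hr =>
    Finset.sum_nonneg fun k _ => mul_nonneg (hr k) (Real.exp_nonneg _)
  obtain ⟨hθ, hη⟩ := mul_lt_one_of_lt_inv_mul_min hT0 (hsum hR) (hsum hρ) hT
  obtain ⟨B, hB⟩ := hA2
  obtain ⟨K, hK⟩ := hF.1.exists_norm_le
  have hremN := fun n N => (hFN N).2.norm_sub_hierTaylor_le hR (hgrowN N) hT0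
    (fun t ht s => (hFN N).2.norm_le hR (hgrowN N) hT0 hθ (hFN N).1 (hB N) ht s) n
  have hrem := hF.2.norm_sub_hierTaylor_le hρ hgrowInf hT0 hK
  have hθ0 := mul_nonneg hT0.le (hsum hR)
  have hη0 := mul_nonneg hT0.le (hsum hρ)
  generalize T * ∑ k ∈ Finset.range (m + 1), R k * Real.exp k = θ at *
  generalize T * ∑ k ∈ Finset.range (m + 1), ρ k * Real.exp k = η at *
  have hB' : 0 ≤ B / (1 - θ) :=
    div_nonneg ((norm_nonneg _).trans (hB 0 0)) (by linarith)
  have hK0 : 0 ≤ K := by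
    have := (norm_nonneg _).trans (hK 0 ⟨le_rfl, hT0.le⟩ 0)
    simpa using this
  generalize B / (1 - θ) = L at *
  intro s φ
  have htail : ∀ {q c : ℝ}, 0 ≤ q → q < 1 →
      Tendsto (fun n : ℕ => ‖φ‖ * (q ^ n * c * Real.exp s)) atTop (nhds 0) := by
    intro q c h0 h1
    simpa using (((tendsto_pow_atTop_nhds_zero_of_lt_one h0 h1).mul_const c).mul_const
      (Real.exp s)).const_mul ‖φ‖
  have happly : ∀ {G : ∀ s, X s} {c t : ℝ}, 0 ≤ c → t ∈ Set.Icc (0 : ℝ) T →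
      ‖G s‖ ≤ c * Real.exp (t / T * s) → |φ (G s)| ≤ ‖φ‖ * (c * Real.exp s) := by
    intro G c t hc ht hG
    refine (φ.le_opNorm (G s)).trans (mul_le_mul_of_nonneg_left (hG.trans ?_) (norm_nonneg φ))
    refine mul_le_mul_of_nonneg_left (Real.exp_le_exp.2 ?_) hc
    exact mul_le_of_le_one_left (Nat.cast_nonneg s) ((div_le_one hT0).2 ht.2)
  rw [Metric.tendstoUniformlyOn_iff]
  intro ε hε
  have hε3 : 0 < ε / 3 := by positivity
  obtain ⟨n, hn1, hn2⟩ := (((htail (c := L) hθ0 hθ).eventually_lt_const hε3).and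
    ((htail (c := K) hη0 hη).eventually_lt_const hε3)).exists
  have htaylor := tendstoUniformlyOn_hierTaylor (PWConv.iterate hA3 hA1) T n s φ
  filter_upwards [Metric.tendstoUniformlyOn_iff.1 htaylor (ε / 3) hε3] with N hN t ht
  have h1 := happly (mul_nonneg (pow_nonneg hθ0 n) hB') ht (hremN n N t ht s)
  have h2 := happly (mul_nonneg (pow_nonneg hη0 n) hK0) ht (hrem n t ht s)
  have h3 := hN t ht
  rw [Pi.sub_apply, map_sub] at h1 h2
  rw [Real.dist_eq] at h3 ⊢
  rw [abs_le] at h1 h2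
  rw [abs_lt] at h3 ⊢
  constructor <;> linarith [h1.1, h1.2, h2.1, h2.2, h3.1, h3.2]
end

section
/- Iterated-power bound for a hierarchy operator: If the operators C_{s,s+k} satisfy the growth condition with constants ρ_0,…,ρ_m, then for every ℓ ∈ ℕ, s ∈ ℕ and F ∈ X, the s-th component of the ℓ-th power of the hierarchy operator satisfies ‖π_s[(𝐂)^ℓ F]‖_{X^(s)} ≤ Σ_{k_1=0}^m ⋯ Σ_{k_ℓ=0}^m s·(s+k_1)·(s+k_1+k_2)⋯(s+k_1+⋯+k_{ℓ−1}) · ρ_{k_1}⋯ρ_{k_ℓ} · ‖π_{s+k_1+⋯+k_ℓ} F‖_{X^(s+k_1+⋯+k_ℓ)}, where π_r F := f^(r) denotes the r-th component of F. -/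
open MeasureTheory Filter Finset

theorem Fin.sum_Iio_succ {M : Type*} [AddCommMonoid M] {n : ℕ} (f : Fin (n + 1) → M)
    (j : Fin n) : ∑ i ∈ Finset.Iio j.succ, f i = f 0 + ∑ i ∈ Finset.Iio j, f i.succ := by
  have h : Finset.Iio j.succ = insert 0 ((Finset.Iio j).map (Fin.succEmb n)) := by
    ext i
    cases i using Fin.cases <;> simp
  rw [h, Finset.sum_insert (by simp), Finset.sum_map]
  rfl

theorem Fin.sum_piFinset_succ {M α : Type*} [AddCommMonoid M] {n : ℕ} (S : Finset α)
    (f : (Fin (n + 1) → α) → M) :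
    ∑ k ∈ Fintype.piFinset (fun _ : Fin (n + 1) => S), f k =
      ∑ a ∈ S, ∑ k ∈ Fintype.piFinset (fun _ : Fin n => S), f (Fin.cons a k) := by
  rw [← Finset.sum_product']
  refine (Finset.sum_equiv (Fin.consEquiv fun _ => α) (fun p => ?_) fun p _ => rfl).symm
  simp [Fintype.mem_piFinset, Fin.forall_fin_succ, Fin.consEquiv]

theorem norm_hierSum_le {X : ℕ → Type*} [∀ s, NormedAddCommGroup (X s)]
    [∀ s, NormedSpace ℝ (X s)] (m : ℕ) (C : ∀ s k : ℕ, X (s + k) →L[ℝ] X s) (ρ : ℕ → ℝ)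
    (hgrow : ∀ s : ℕ, ∀ k ≤ m, ∀ f : X (s + k), ‖C s k f‖ ≤ ρ k * s * ‖f‖)
    (F : ∀ s, X s) (s : ℕ) :
    ‖hierSum m C F s‖ ≤ ∑ k ∈ Finset.range (m + 1), ρ k * s * ‖F (s + k)‖ :=
  norm_sum_le_of_le _ fun k hk => hgrow s k (Nat.lt_succ_iff.mp (Finset.mem_range.mp hk)) _

/-- **Iterated-power bound for a hierarchy operator** (Lemma 5.1 of the paper). If the operators
`C_{s,s+k}` satisfy the growth condition with constants `ρ_0,…,ρ_m`, then for every `ℓ, s ∈ ℕ`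
and `F ∈ X`,
`‖π_s[(𝐂)^ℓ F]‖ ≤ Σ_{k_1,…,k_ℓ=0}^m s(s+k_1)⋯(s+k_1+⋯+k_{ℓ−1}) ρ_{k_1}⋯ρ_{k_ℓ}
  ‖π_{s+k_1+⋯+k_ℓ} F‖`. -/
theorem stmt2 {X : ℕ → Type*} [∀ s, NormedAddCommGroup (X s)] [∀ s, NormedSpace ℝ (X s)]
    (m : ℕ) (C : ∀ s k : ℕ, X (s + k) →L[ℝ] X s)
    (ρ : ℕ → ℝ) (hρ : ∀ k, 0 ≤ ρ k)
    (hgrow : ∀ s : ℕ, ∀ k ≤ m, ∀ f : X (s + k), ‖C s k f‖ ≤ ρ k * s * ‖f‖)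
    (ℓ s : ℕ) (F : ∀ s, X s) :
    ‖(fun G => hierSum m C G)^[ℓ] F s‖ ≤
      ∑ k ∈ Fintype.piFinset (fun _ : Fin ℓ => Finset.range (m + 1)),
        (∏ j : Fin ℓ, ((s : ℝ) + ∑ i ∈ Finset.Iio j, (k i : ℝ))) *
          (∏ j : Fin ℓ, ρ (k j)) *
          ‖F (s + ∑ i : Fin ℓ, k i)‖ := by
  induction ℓ generalizing s with
  | zero =>
    have hF (k : Fin 0 → ℕ) : ‖F (s + ∑ i, k i)‖ = ‖F s‖ :=
      congrArg (fun r => ‖F r‖) (by simp)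
    simp [hF]
  | succ n ih =>
    rw [Function.iterate_succ_apply', Fin.sum_piFinset_succ]
    refine (norm_hierSum_le m C ρ hgrow _ s).trans (Finset.sum_le_sum fun a _ => ?_)
    refine (mul_le_mul_of_nonneg_left (ih (s + a))
      (mul_nonneg (hρ a) s.cast_nonneg)).trans_eq ?_
    rw [Finset.mul_sum]
    refine Finset.sum_congr rfl fun k _ => ?_
    have hzero : Finset.Iio (0 : Fin (n + 1)) = ∅ := Finset.Iio_bot
    have hF : ‖F (s + ∑ i, (Fin.cons a k : Fin (n + 1) → ℕ) i)‖ = ‖F (s + a + ∑ i, k i)‖ :=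
      congrArg (fun r => ‖F r‖) (by simp [Fin.sum_univ_succ, add_assoc])
    rw [hF]
    simp only [Fin.prod_univ_succ, Fin.sum_Iio_succ, Fin.cons_zero,
      Fin.cons_succ, hzero, Finset.sum_empty, add_zero, Nat.cast_add, add_assoc]
    ring
end

section
/- The marginals of the Master equation solve the BBGKY hierarchy: Let N ≥ M and let f_N(t) = e^{tΩ} f_{N,0} be the solution of the Master equation with initial datum f_{N,0} ∈ L^1_sym(ℝ^{dN}). Then for every 1 ≤ s ≤ N and every t, the marginals satisfy ∂_t f_N^(s)(t) = Σ_{k=0}^{M−1} C^N_{s,s+k} f_N^(s+k)(t) in L^1_sym(ℝ^{ds}). -/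
open MeasureTheory Filter Finset
open scoped Classical

noncomputable section

/-- The single-particle velocity space `ℝ^d`. -/
abbrev ESp (d : ℕ) := EuclideanSpace ℝ (Fin d)

/-- Action of a permutation of `{1,…,K}` on `ℝ^{dK}`, permuting the `K` blocks of `ℝ^d`:
`σ(V)_i = V_{σ(i)}`. -/
def permAct {d K : ℕ} (σ : Equiv.Perm (Fin K)) (V : Fin K → ESp d) : Fin K → ESp d :=
  fun i => V (σ i)

/-- `f` is invariant under permutations of its `n` blocks of `d` variables. -/
def SymFun {d n : ℕ} (f : (Fin n → ESp d) → ℝ) : Prop :=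
  ∀ σ : Equiv.Perm (Fin n), ∀ V : Fin n → ESp d, f (fun j => V (σ j)) = f V

/-- Extension `T^ω_{i_1⋯i_K}` of a `K`-particle map to `N` particles: the particles labelled by
`ι` collide according to `Tω`, the others are untouched. -/
def extendMap {d K N : ℕ} (Tω : (Fin K → ESp d) → Fin K → ESp d)
    (ι : Fin K → Fin N) (V : Fin N → ESp d) : Fin N → ESp d :=
  fun j => if h : ∃ a, ι a = j then Tω (fun a => V (ι a)) h.choose else V j

/-- **(H1)**: each `T_K^ω` conserves kinetic energy (is an isometry of `ℝ^{dK}`). -/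
def KacH1 (d M : ℕ) (S : ℕ → Type*)
    (T : ∀ K, S K → (Fin K → ESp d) ≃ₗ[ℝ] (Fin K → ESp d)) : Prop :=
  ∀ K, 1 ≤ K → K ≤ M → ∀ ω : S K, ∀ V : Fin K → ESp d,
    ∑ i : Fin K, ‖T K ω V i‖ ^ 2 = ∑ i : Fin K, ‖V i‖ ^ 2

/-- **(H2)**: on average over the collision kernel, `T_K` is an involution. -/
def KacH2 (d M : ℕ) (S : ℕ → Type*) [∀ K, MeasurableSpace (S K)]
    (b : ∀ K, Measure (S K))
    (T : ∀ K, S K → (Fin K → ESp d) ≃ₗ[ℝ] (Fin K → ESp d)) : Prop :=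
  ∀ K, 1 ≤ K → K ≤ M → ∀ φ : (Fin K → ESp d) → ℝ, Continuous φ →
    ∀ V : Fin K → ESp d,
      ∫ ω, φ ((T K ω).symm V) ∂(b K) = ∫ ω, φ (T K ω V) ∂(b K)

/-- **(H3)**: on average over the collision kernel, `T_K` is invariant under relabelling of the
particles: `∫ φ((σ∘T_K^ω∘σ⁻¹)V) db_K = ∫ φ(T_K^ω V) db_K`. -/
def KacH3 (d M : ℕ) (S : ℕ → Type*) [∀ K, MeasurableSpace (S K)]
    (b : ∀ K, Measure (S K))
    (T : ∀ K, S K → (Fin K → ESp d) ≃ₗ[ℝ] (Fin K → ESp d)) : Prop :=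
  ∀ K, 1 ≤ K → K ≤ M → ∀ σ : Equiv.Perm (Fin K), ∀ φ : (Fin K → ESp d) → ℝ, Continuous φ →
    ∀ V : Fin K → ESp d,
      ∫ ω, φ (permAct σ (T K ω (permAct σ⁻¹ V))) ∂(b K) = ∫ ω, φ (T K ω V) ∂(b K)

/-- Joint measurability of the transformation laws. -/
def KacMeas (d : ℕ) (S : ℕ → Type*) [∀ K, MeasurableSpace (S K)]
    (T : ∀ K, S K → (Fin K → ESp d) ≃ₗ[ℝ] (Fin K → ESp d)) : Prop :=
  ∀ K, Measurable (fun p : S K × (Fin K → ESp d) => T K p.1 p.2)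

/-- The operator `Ω_{i_1⋯i_K} f = ∫_{S_K} (f∘T^ω_{i_1⋯i_K} − f) db_K(ω)`. -/
def OmegaIdx {d : ℕ} {S : ℕ → Type*} [∀ K, MeasurableSpace (S K)]
    (b : ∀ K, Measure (S K))
    (T : ∀ K, S K → (Fin K → ESp d) ≃ₗ[ℝ] (Fin K → ESp d))
    (K N : ℕ) (ι : Fin K → Fin N) (f : (Fin N → ESp d) → ℝ) : (Fin N → ESp d) → ℝ :=
  fun V => ∫ ω, (f (extendMap (⇑(T K ω)) ι V) - f V) ∂(b K)

/-- The index map selecting the slots `i_1,…,i_n, s+1,…,s+r` among `s + r` particles. -/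
def collIdx (s n r K : ℕ) (hK : K = n + r) (i : Fin n → Fin s) : Fin K → Fin (s + r) :=
  fun a =>
    if h : (a : ℕ) < n then Fin.castLE (Nat.le_add_right s r) (i ⟨a, h⟩)
    else ⟨s + ((a : ℕ) - n), by have := a.isLt; omega⟩

/-- The collision operator `C^{s,K,n}_{i_1⋯i_n} : L¹_sym(ℝ^{d(s+r)}) → L¹_sym(ℝ^{ds})`,
`r = K − n`, from Definition 6.1 of the paper. -/
def collOp {d : ℕ} {S : ℕ → Type*} [∀ K, MeasurableSpace (S K)]
    (b : ∀ K, Measure (S K))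
    (T : ∀ K, S K → (Fin K → ESp d) ≃ₗ[ℝ] (Fin K → ESp d))
    (s n r K : ℕ) (hK : K = n + r) (i : Fin n → Fin s)
    (g : (Fin (s + r) → ESp d) → ℝ) : (Fin s → ESp d) → ℝ :=
  fun V => ∫ p : S K × (Fin r → ESp d),
    (g (extendMap (⇑(T K p.1)) (collIdx s n r K hK i) (Fin.append V p.2)) -
      g (Fin.append V p.2)) ∂((b K).prod volume)

/-- The marginal (partial trace) `Tr_{j+1,…,N} f` of an `N`-particle density; it is the zero
function for `j > N`. -/
def margOf {d : ℕ} (N j : ℕ) (f : (Fin N → ESp d) → ℝ) : (Fin j → ESp d) → ℝ :=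
  if h : j ≤ N then
    fun V => ∫ w : Fin (N - j) → ESp d, f (fun a => Fin.append V w (Fin.cast (by omega) a))
  else 0

/-- The BBGKY-hierarchy operator
`C^N_{s,s+k} = Σ_{n=1}^{M−k} β_{k+n} (N/binom(N,k+n)) binom(N−s,k)
  Σ_{i_1<⋯<i_n≤s} C^{s,k+n,n}_{i_1⋯i_n}` (zero when `s + k > N`). -/
def bbgkyC {d : ℕ} {S : ℕ → Type*} [∀ K, MeasurableSpace (S K)]
    (b : ∀ K, Measure (S K))
    (T : ∀ K, S K → (Fin K → ESp d) ≃ₗ[ℝ] (Fin K → ESp d))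
    (M : ℕ) (β : ℕ → ℝ) (N s k : ℕ)
    (g : (Fin (s + k) → ESp d) → ℝ) : (Fin s → ESp d) → ℝ :=
  fun V =>
    if s + k ≤ N then
      ∑ n ∈ Finset.Icc 1 (M - k),
        β (k + n) * ((N : ℝ) / (N.choose (k + n) : ℝ)) * ((N - s).choose k : ℝ) *
          ∑ i : Fin n → Fin s,
            (if StrictMono i then collOp b T s n k (k + n) (by omega) i g V else 0)
    else 0

/-- The Boltzmann-hierarchy operator
`(C^∞_{s,s+k} g)(V_s) = β_{k+1}(k+1) Σ_{i=1}^s ∫ (g(V^{*i}_{s+k}) − g(V_{s+k})) db dv`. -/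
def boltzC {d : ℕ} {S : ℕ → Type*} [∀ K, MeasurableSpace (S K)]
    (b : ∀ K, Measure (S K))
    (T : ∀ K, S K → (Fin K → ESp d) ≃ₗ[ℝ] (Fin K → ESp d))
    (β : ℕ → ℝ) (s k : ℕ)
    (g : (Fin (s + k) → ESp d) → ℝ) : (Fin s → ESp d) → ℝ :=
  fun V => β (k + 1) * ((k : ℝ) + 1) *
    ∑ i : Fin s, collOp b T s 1 k (k + 1) (by omega) (fun _ => i) g V

/-- The generator `Ω` of the Master equation of the generalized Kac model. -/
def masterGen {d : ℕ} {S : ℕ → Type*} [∀ K, MeasurableSpace (S K)]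
    (b : ∀ K, Measure (S K))
    (T : ∀ K, S K → (Fin K → ESp d) ≃ₗ[ℝ] (Fin K → ESp d))
    (M : ℕ) (β : ℕ → ℝ) (N : ℕ)
    (f : (Fin N → ESp d) → ℝ) : (Fin N → ESp d) → ℝ :=
  fun V => (N : ℝ) * ∑ K ∈ Finset.Icc 1 M,
    β K * (1 / ((K.factorial : ℝ) * (N.choose K : ℝ))) *
      ∑ ι : Fin K → Fin N,
        (if Function.Injective ι then OmegaIdx b T K N ι f V else 0)

/-- The solution `e^{tΩ} f₀` of the Master equation, as a pointwise exponential series. -/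
def masterSol {d : ℕ} {S : ℕ → Type*} [∀ K, MeasurableSpace (S K)]
    (b : ∀ K, Measure (S K))
    (T : ∀ K, S K → (Fin K → ESp d) ≃ₗ[ℝ] (Fin K → ESp d))
    (M : ℕ) (β : ℕ → ℝ) (N : ℕ)
    (f₀ : (Fin N → ESp d) → ℝ) (t : ℝ) : (Fin N → ESp d) → ℝ :=
  fun V => ∑' n : ℕ, (t ^ n / (n.factorial : ℝ)) * (masterGen b T M β N)^[n] f₀ V

/-- `f` has `g` as derivative at time `t` in the `L¹(μ)` sense. -/
def HasL1DerivAt {α : Type*} [MeasurableSpace α] (μ : Measure α)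
    (f : ℝ → α → ℝ) (g : α → ℝ) (t : ℝ) : Prop :=
  Tendsto (fun h : ℝ => ∫ x, |(f (t + h) x - f t x) / h - g x| ∂μ)
    (nhdsWithin 0 {(0 : ℝ)}ᶜ) (nhds 0)

/-- A bounded measurable test function (an element of `L^∞`). -/
def BddMeas {α : Type*} [MeasurableSpace α] (φ : α → ℝ) : Prop :=
  Measurable φ ∧ ∃ C : ℝ, ∀ x, |φ x| ≤ C

end

/-- The pointwise-defined operator `A` is represented by a bounded operator on `L¹`. -/
def IsL1Op {X Y : Type*} [MeasurableSpace X] [MeasurableSpace Y] (μ : Measure X) (ν : Measure Y)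
    (A : (X → ℝ) → Y → ℝ) : Prop :=
  ∃ Φ : (X →₁[μ] ℝ) →L[ℝ] (Y →₁[ν] ℝ),
    ∀ f, ∀ hf : Integrable f μ, A f =ᵐ[ν] Φ (hf.toL1 f)

namespace IsL1Op

variable {X Y Z : Type*} [MeasurableSpace X] [MeasurableSpace Y] [MeasurableSpace Z]
  {μ : Measure X} {ν : Measure Y} {ρ : Measure Z}

theorem integrable {A : (X → ℝ) → Y → ℝ} (hA : IsL1Op μ ν A) {f : X → ℝ} (hf : Integrable f μ) :
    Integrable (A f) ν := by
  obtain ⟨Φ, hΦ⟩ := hA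
  exact (L1.integrable_coeFn _).congr (hΦ f hf).symm

theorem congr {A : (X → ℝ) → Y → ℝ} (hA : IsL1Op μ ν A) {f g : X → ℝ} (hf : Integrable f μ)
    (h : f =ᵐ[μ] g) : A f =ᵐ[ν] A g := by
  obtain ⟨Φ, hΦ⟩ := hA
  have hg := hf.congr h
  have : hf.toL1 f = hg.toL1 g := (Integrable.toL1_eq_toL1_iff _ _ _ _).2 h
  exact (hΦ f hf).trans ((this ▸ (hΦ g hg).symm))

theorem zero : IsL1Op μ ν (fun _ _ => 0) :=
  ⟨0, fun f hf => by
    filter_upwards [Lp.coeFn_zero ℝ 1 ν] with y hy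
    simpa using hy.symm⟩

theorem add {A B : (X → ℝ) → Y → ℝ} (hA : IsL1Op μ ν A) (hB : IsL1Op μ ν B) :
    IsL1Op μ ν (fun f y => A f y + B f y) := by
  obtain ⟨Φ, hΦ⟩ := hA
  obtain ⟨Ψ, hΨ⟩ := hB
  refine ⟨Φ + Ψ, fun f hf => ?_⟩
  filter_upwards [hΦ f hf, hΨ f hf, Lp.coeFn_add (Φ (hf.toL1 f)) (Ψ (hf.toL1 f))] with y h h' h''
  exact (congrArg₂ (· + ·) h h').trans h''.symm

theorem const_mul {A : (X → ℝ) → Y → ℝ} (hA : IsL1Op μ ν A) (c : ℝ) :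
    IsL1Op μ ν (fun f y => c * A f y) := by
  obtain ⟨Φ, hΦ⟩ := hA
  refine ⟨c • Φ, fun f hf => ?_⟩
  filter_upwards [hΦ f hf, Lp.coeFn_smul c (Φ (hf.toL1 f))] with y h h'
  simp [h, h']

theorem sub {A B : (X → ℝ) → Y → ℝ} (hA : IsL1Op μ ν A) (hB : IsL1Op μ ν B) :
    IsL1Op μ ν (fun f y => A f y - B f y) := by
  simpa [sub_eq_add_neg] using hA.add (hB.const_mul (-1))

theorem sum {κ : Type*} {A : κ → (X → ℝ) → Y → ℝ} (J : Finset κ)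
    (hA : ∀ j ∈ J, IsL1Op μ ν (A j)) :
    IsL1Op μ ν (fun f y => ∑ j ∈ J, A j f y) := by
  induction J using Finset.induction_on with
  | empty => simpa using zero
  | insert a J ha ih =>
    simp only [Finset.sum_insert ha]
    exact (hA a (by simp)).add (ih fun j hj => hA j (by simp [hj]))

theorem comp {A : (X → ℝ) → Y → ℝ} {B : (Y → ℝ) → Z → ℝ} (hB : IsL1Op ν ρ B)
    (hA : IsL1Op μ ν A) : IsL1Op μ ρ (fun f => B (A f)) := by
  have hA' := hA
  obtain ⟨Φ, hΦ⟩ := hA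
  obtain ⟨Ψ, hΨ⟩ := hB
  refine ⟨Ψ.comp Φ, fun f hf => ?_⟩
  have h := hA'.integrable hf
  have : h.toL1 (A f) = Φ (hf.toL1 f) := by
    apply Lp.ext
    exact (Integrable.coeFn_toL1 h).trans (hΦ f hf)
  have h' := hΨ _ h
  rw [this] at h'
  exact h'

theorem of_measurePreserving {G : Y → X} (hG : MeasurePreserving G ν μ) :
    IsL1Op μ ν (fun f y => f (G y)) := by
  refine ⟨(Lp.compMeasurePreservingₗᵢ ℝ G hG).toContinuousLinearMap, fun f hf => ?_⟩
  have h := Lp.coeFn_compMeasurePreserving (hf.toL1 f) hG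
  exact (hG.quasiMeasurePreserving.ae_eq_comp (Integrable.coeFn_toL1 hf).symm).trans h.symm

theorem integral_right [SFinite μ] [SFinite ν] :
    IsL1Op (μ.prod ν) μ (fun F x => ∫ y, F (x, y) ∂ν) := by
  have key : ∀ F : (X × Y) →₁[μ.prod ν] ℝ, Integrable (fun x => ∫ y, F (x, y) ∂ν) μ :=
    fun F => (L1.integrable_coeFn F).integral_prod_left
  let L : ((X × Y) →₁[μ.prod ν] ℝ) →ₗ[ℝ] (X →₁[μ] ℝ) :=
    { toFun := fun F => (key F).toL1 _
      map_add' := fun F G => by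
        rw [← Integrable.toL1_add, Integrable.toL1_eq_toL1_iff]
        filter_upwards [Measure.ae_ae_of_ae_prod (Lp.coeFn_add F G),
          (L1.integrable_coeFn F).prod_right_ae, (L1.integrable_coeFn G).prod_right_ae]
          with x hx hF hG
        rw [integral_congr_ae hx]
        exact integral_add hF hG
      map_smul' := fun c F => by
        simp only [RingHom.id_apply]
        rw [← Integrable.toL1_smul, Integrable.toL1_eq_toL1_iff]
        filter_upwards [Measure.ae_ae_of_ae_prod (Lp.coeFn_smul c F)] with x hx
        rw [integral_congr_ae hx]
        exact integral_const_mul _ _ }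
  refine ⟨L.mkContinuous 1 fun F => ?_, fun f hf => ?_⟩
  · change ‖(key F).toL1 _‖ ≤ _
    rw [one_mul, L1.norm_eq_integral_norm, L1.norm_eq_integral_norm,
      integral_prod _ (L1.integrable_coeFn F).norm,
      integral_congr_ae ((Integrable.coeFn_toL1 (key F)).mono fun x hx => congrArg norm hx)]
    refine integral_mono (key F).norm (L1.integrable_coeFn F).norm.integral_prod_left fun x => ?_
    exact norm_integral_le_integral_norm _
  · refine EventuallyEq.trans ?_ (Integrable.coeFn_toL1 (key (hf.toL1 f))).symm
    filter_upwards [Measure.ae_ae_of_ae_prod (Integrable.coeFn_toL1 hf)] with x hx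
    exact (integral_congr_ae hx).symm

theorem integral_left [SFinite μ] [SFinite ν] :
    IsL1Op (μ.prod ν) ν (fun F y => ∫ x, F (x, y) ∂μ) :=
  (integral_right (μ := ν) (ν := μ)).comp
    (of_measurePreserving (Measure.measurePreserving_swap (μ := ν) (ν := μ)))

theorem map_add {A : (X → ℝ) → Y → ℝ} (hA : IsL1Op μ ν A) {f g : X → ℝ} (hf : Integrable f μ)
    (hg : Integrable g μ) : A (fun x => f x + g x) =ᵐ[ν] fun y => A f y + A g y := by
  obtain ⟨Φ, hΦ⟩ := hA
  have h := hΦ _ (hf.add hg)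
  rw [Integrable.toL1_add f g hf hg, _root_.map_add] at h
  filter_upwards [h, hΦ f hf, hΦ g hg, Lp.coeFn_add (Φ (hf.toL1 f)) (Φ (hg.toL1 g))]
    with y h h' h'' h3
  rw [h', h'']
  exact h.trans h3

theorem map_const_mul {A : (X → ℝ) → Y → ℝ} (hA : IsL1Op μ ν A) {f : X → ℝ}
    (hf : Integrable f μ) (c : ℝ) : A (fun x => c * f x) =ᵐ[ν] fun y => c * A f y := by
  obtain ⟨Φ, hΦ⟩ := hA
  have h := hΦ (fun x => c * f x) (hf.smul c)
  rw [show (hf.smul c).toL1 (fun x => c * f x) = c • hf.toL1 f from Integrable.toL1_smul f hf c,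
    _root_.map_smul] at h
  filter_upwards [h, hΦ f hf, Lp.coeFn_smul c (Φ (hf.toL1 f))] with y h h' h3
  rw [h']
  exact h.trans h3

theorem map_sum {A : (X → ℝ) → Y → ℝ} (hA : IsL1Op μ ν A) {κ : Type*} (J : Finset κ)
    {g : κ → X → ℝ} (hg : ∀ j ∈ J, Integrable (g j) μ) :
    A (fun x => ∑ j ∈ J, g j x) =ᵐ[ν] fun y => ∑ j ∈ J, A (g j) y := by
  induction J using Finset.induction_on with
  | empty =>
    have := hA.map_const_mul (integrable_zero X ℝ μ) 0
    simpa using this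
  | insert a J ha ih =>
    simp only [Finset.sum_insert ha]
    refine (hA.map_add (hg a (by simp))
      (integrable_finsetSum J fun j hj => hg j (by simp [hj]))).trans ?_
    filter_upwards [ih fun j hj => hg j (by simp [hj])] with y hy
    rw [hy]

end IsL1Op

/-- The exponential series of an `L¹`-bounded operator, summed pointwise, is differentiable in
`L¹` after applying a further `L¹`-bounded operator. -/
theorem IsL1Op.hasL1DerivAt_expSeries {X Y : Type*} [MeasurableSpace X] [MeasurableSpace Y]
    {μ : Measure X} {ν : Measure Y} {A : (X → ℝ) → X → ℝ} (hA : IsL1Op μ μ A)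
    {P : (X → ℝ) → Y → ℝ} (hP : IsL1Op μ ν P) {f₀ : X → ℝ} (hf₀ : Integrable f₀ μ)
    {u : ℝ → X → ℝ} (hu : ∀ τ x, u τ x = ∑' n : ℕ, (τ ^ n / (n.factorial : ℝ)) * A^[n] f₀ x)
    (t : ℝ) :
    Integrable (u t) μ ∧ ∀ g : Y → ℝ, P (A (u t)) =ᵐ[ν] g →
      HasL1DerivAt ν (fun τ => P (u τ)) g t := by
  have hA' := hA
  obtain ⟨Φ, hΦ⟩ := hA
  have hiter : ∀ n : ℕ, ∃ h : Integrable (A^[n] f₀) μ,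
      h.toL1 (A^[n] f₀) = (Φ ^ n) (hf₀.toL1 f₀) := by
    intro n
    induction n with
    | zero => exact ⟨hf₀, by simp⟩
    | succ n ih =>
      obtain ⟨h, e⟩ := ih
      rw [Function.iterate_succ_apply']
      refine ⟨hA'.integrable h, ?_⟩
      rw [pow_succ', mul_apply_eq_comp, ← e]
      apply Lp.ext
      exact (Integrable.coeFn_toL1 _).trans (hΦ _ h)
  set x₀ := hf₀.toL1 f₀
  let x : ℝ → (X →₁[μ] ℝ) := fun τ => NormedSpace.exp (τ • Φ) x₀
  have hx : ∀ τ, u τ =ᵐ[μ] x τ := by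
    intro τ
    have hs : HasSum (fun n : ℕ => (n.factorial⁻¹ : ℝ) • (τ • Φ) ^ n) (NormedSpace.exp (τ • Φ)) :=
      NormedSpace.exp_series_hasSum_exp' (𝕂 := ℝ) (τ • Φ)
    have hs' := (ContinuousLinearMap.apply ℝ (X →₁[μ] ℝ) x₀).hasSum hs
    have hn : Summable fun n : ℕ => ‖((n.factorial⁻¹ : ℝ) • (τ • Φ) ^ n) x₀‖ := by
      have h := NormedSpace.norm_expSeries_summable' (𝕂 := ℝ) (τ • Φ)
      refine Summable.of_nonneg_of_le (fun _ => norm_nonneg _) (fun n => ?_) (h.mul_right ‖x₀‖)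
      exact ContinuousLinearMap.le_opNorm _ _
    have hne : ∑' n : ℕ, ‖((n.factorial⁻¹ : ℝ) • (τ • Φ) ^ n) x₀‖ₑ ≠ ⊤ :=
      tsum_enorm_ne_top_iff_summable_norm.2 hn
    have hc : ∀ᵐ y ∂μ, ∀ n : ℕ, (((n.factorial⁻¹ : ℝ) • (τ • Φ) ^ n) x₀ : X →₁[μ] ℝ) y
        = (τ ^ n / (n.factorial : ℝ)) * A^[n] f₀ y := by
      rw [ae_all_iff]
      intro n
      obtain ⟨h, e⟩ := hiter n
      have e2 : (((n.factorial⁻¹ : ℝ) • (τ • Φ) ^ n) x₀ : X →₁[μ] ℝ)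
          = (τ ^ n / (n.factorial : ℝ)) • h.toL1 (A^[n] f₀) := by
        rw [e, smul_pow, smul_smul, smul_apply]
        congr 1
        field_simp
      rw [e2]
      filter_upwards [Lp.coeFn_smul (τ ^ n / (n.factorial : ℝ)) (h.toL1 (A^[n] f₀)),
        Integrable.coeFn_toL1 h] with y h1 h2
      rw [h1, Pi.smul_apply, h2, smul_eq_mul]
    filter_upwards [Lp.hasSum_coeFn_tsum hne, hc] with y hy hy'
    rw [hu, ← tsum_congr hy', hy.tsum_eq]
    have : x τ = ∑' n : ℕ, ((n.factorial⁻¹ : ℝ) • (τ • Φ) ^ n) x₀ := hs'.tsum_eq.symm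
    rw [this]
  have hui : ∀ τ, Integrable (u τ) μ := fun τ => (L1.integrable_coeFn (x τ)).congr (hx τ).symm
  have hut : ∀ τ, (hui τ).toL1 (u τ) = x τ := fun τ =>
    Lp.ext ((Integrable.coeFn_toL1 _).trans (hx τ))
  refine ⟨hui t, fun g hg => ?_⟩
  obtain ⟨Ψ, hΨ⟩ := hP
  have hder : HasDerivAt (fun τ => Ψ (x τ)) (Ψ (Φ (x t))) t := by
    have h := hasDerivAt_exp_smul_const' (𝕂 := ℝ) Φ t
    have h2 := ((ContinuousLinearMap.apply ℝ (X →₁[μ] ℝ) x₀).hasFDerivAt.comp_hasDerivAt t h)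
    exact Ψ.hasFDerivAt.comp_hasDerivAt t h2
  have hg' : g =ᵐ[ν] Ψ (Φ (x t)) := by
    have h1 := hA'.integrable (hui t)
    have : h1.toL1 (A (u t)) = Φ (x t) := by
      rw [← hut]
      exact Lp.ext ((Integrable.coeFn_toL1 _).trans (hΦ _ _))
    rw [← this]
    exact hg.symm.trans (hΨ _ h1)
  have hPu : ∀ τ, P (u τ) =ᵐ[ν] Ψ (x τ) := fun τ => by
    rw [← hut]
    exact hΨ _ (hui τ)
  have hlim := (hasDerivAt_iff_tendsto_slope_zero.1 hder).sub_const (Ψ (Φ (x t)))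
  rw [sub_self] at hlim
  refine (tendsto_zero_iff_norm_tendsto_zero.1 hlim).congr fun h => ?_
  rw [L1.norm_eq_integral_norm]
  refine integral_congr_ae ?_
  filter_upwards [hPu t, hPu (t + h), hg', Lp.coeFn_sub (Ψ (x (t + h))) (Ψ (x t)),
    Lp.coeFn_smul h⁻¹ (Ψ (x (t + h)) - Ψ (x t)),
    Lp.coeFn_sub (h⁻¹ • (Ψ (x (t + h)) - Ψ (x t))) (Ψ (Φ (x t)))] with y e1 e2 e3 e4 e5 e6
  simp only [e6, Pi.sub_apply, e5, Pi.smul_apply, e4, e1, e2, e3, Real.norm_eq_abs, smul_eq_mul]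
  congr 1
  ring

theorem extendMap_apply {d K N : ℕ} (Tω : (Fin K → ESp d) → Fin K → ESp d) {ι : Fin K → Fin N}
    (hι : Function.Injective ι) (V : Fin N → ESp d) (a : Fin K) :
    extendMap Tω ι V (ι a) = Tω (fun a => V (ι a)) a := by
  have h : ∃ a', ι a' = ι a := ⟨a, rfl⟩
  rw [extendMap, dif_pos h, hι h.choose_spec]

theorem extendMap_apply_of_notMem {d K N : ℕ} (Tω : (Fin K → ESp d) → Fin K → ESp d)
    {ι : Fin K → Fin N} (V : Fin N → ESp d) {j : Fin N} (hj : ∀ a, ι a ≠ j) :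
    extendMap Tω ι V j = V j :=
  dif_neg fun ⟨a, ha⟩ => hj a ha

/-- `extendMap` depends on `V` only through the untouched velocities and the output of `Tω`. -/
theorem measurable_extendMap {d K N : ℕ} {A : Type*} [MeasurableSpace A]
    {ι : Fin K → Fin N} {G : A → (Fin K → ESp d) → Fin K → ESp d} {W : A → Fin N → ESp d}
    (hG : Measurable fun p : A × (Fin K → ESp d) => G p.1 p.2) (hW : Measurable W) :
    Measurable fun p => extendMap (G p) ι (W p) := by
  rw [measurable_pi_iff]
  intro j
  have hWι : Measurable fun p => (fun a => W p (ι a)) :=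
    measurable_pi_iff.2 fun a => (measurable_pi_apply _).comp hW
  by_cases h : ∃ a, ι a = j
  · simp only [extendMap, dif_pos h]
    exact (measurable_pi_apply _).comp (hG.comp (measurable_id.prodMk hWι))
  · simp only [extendMap, dif_neg h]
    exact (measurable_pi_apply _).comp hW

theorem sum_norm_sq_extendMap {d K N : ℕ} {Tω : (Fin K → ESp d) → Fin K → ESp d}
    (hT : ∀ V, ∑ i, ‖Tω V i‖ ^ 2 = ∑ i, ‖V i‖ ^ 2)
    {ι : Fin K → Fin N} (hι : Function.Injective ι) (V : Fin N → ESp d) :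
    ∑ j, ‖extendMap Tω ι V j‖ ^ 2 = ∑ j, ‖V j‖ ^ 2 := by
  have key : ∀ W : Fin N → ESp d, ∑ j, ‖W j‖ ^ 2 =
      ∑ a, ‖W (ι a)‖ ^ 2 + ∑ j ∈ (univ.image ι)ᶜ, ‖W j‖ ^ 2 := fun W => by
    rw [← Finset.sum_add_sum_compl (univ.image ι), Finset.sum_image fun _ _ _ _ h => hι h]
  rw [key, key V]
  simp only [extendMap_apply _ hι, hT]
  congr 1
  refine Finset.sum_congr rfl fun j hj => ?_
  rw [extendMap_apply_of_notMem]
  simpa using hj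

/-- A linear map of `ℝ^{dn}` preserving the kinetic energy preserves Lebesgue measure. -/
theorem measurePreserving_of_sum_norm_sq {d n : ℕ} (L : (Fin n → ESp d) →ₗ[ℝ] (Fin n → ESp d))
    (h : ∀ V, ∑ i, ‖L V i‖ ^ 2 = ∑ i, ‖V i‖ ^ 2) : MeasurePreserving L volume volume := by
  have hinj : Function.Injective L := by
    rw [injective_iff_map_eq_zero]
    intro V hV
    have h' := h V
    rw [hV] at h'
    have h0 : ∑ i, ‖V i‖ ^ 2 = 0 := by simpa using h'.symm
    rw [Finset.sum_eq_zero_iff_of_nonneg fun _ _ => by positivity] at h0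
    ext1 i
    simpa using h0 i (mem_univ i)
  have hdet : LinearMap.det L ≠ 0 := (LinearMap.isUnit_det L
    ((LinearMap.isUnit_iff_ker_eq_bot L).2 (LinearMap.ker_eq_bot.2 hinj))).ne_zero
  have hmap := Measure.map_linearMap_addHaar_eq_smul_addHaar
    (volume : Measure (Fin n → ESp d)) hdet
  have hLm : Measurable L := (LinearMap.continuous_of_finiteDimensional L).measurable
  refine ⟨hLm, ?_⟩
  have hcont : Continuous fun V : Fin n → ESp d => ∑ i, ‖V i‖ ^ 2 := by fun_prop
  let B : Set (Fin n → ESp d) := {V | ∑ i, ‖V i‖ ^ 2 ≤ 1}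
  have hBm : MeasurableSet B := (isClosed_le hcont continuous_const).measurableSet
  have hpre : L ⁻¹' B = B := by
    ext V
    simp only [B, Set.mem_preimage, Set.mem_ofPred_eq, h]
  have hpos : volume B ≠ 0 := by
    have ho : IsOpen {V : Fin n → ESp d | ∑ i, ‖V i‖ ^ 2 < 1} :=
      isOpen_lt hcont continuous_const
    have := ho.measure_pos volume ⟨0, by simp⟩
    exact (this.trans_le (measure_mono fun V hV => le_of_lt (Set.mem_ofPred_eq ▸ hV))).ne'
  have hfin : volume B ≠ ⊤ := by
    have hsub : B ⊆ Metric.closedBall 0 1 := by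
      intro V hV
      rw [mem_closedBall_zero_iff, pi_norm_le_iff_of_nonneg zero_le_one]
      intro i
      have h1 : ‖V i‖ ^ 2 ≤ ∑ i, ‖V i‖ ^ 2 :=
        Finset.single_le_sum (f := fun i => ‖V i‖ ^ 2) (fun _ _ => by positivity) (mem_univ i)
      have h2 : ∑ i, ‖V i‖ ^ 2 ≤ 1 := hV
      nlinarith [norm_nonneg (V i)]
    exact ((measure_mono hsub).trans_lt measure_closedBall_lt_top).ne
  have hB := congrArg (fun m => m B) hmap
  simp only [Measure.map_apply hLm hBm, hpre, Measure.smul_apply, smul_eq_mul] at hB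
  have hc : ENNReal.ofReal |(LinearMap.det L)⁻¹| = 1 := by
    have := (ENNReal.mul_left_inj hpos hfin).1 ((one_mul (volume B)).trans hB)
    exact this.symm
  rw [hmap, hc, one_smul]

theorem measurePreserving_extendMap {d K N : ℕ} (L : (Fin K → ESp d) →ₗ[ℝ] (Fin K → ESp d))
    (hL : ∀ V, ∑ i, ‖L V i‖ ^ 2 = ∑ i, ‖V i‖ ^ 2) {ι : Fin K → Fin N}
    (hι : Function.Injective ι) : MeasurePreserving (extendMap L ι) volume volume := by
  let E : (Fin N → ESp d) →ₗ[ℝ] (Fin N → ESp d) :=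
    { toFun := extendMap L ι
      map_add' := fun V W => by
        ext1 j
        by_cases h : ∃ a, ι a = j
        · obtain ⟨a, rfl⟩ := h
          simp only [Pi.add_apply, extendMap_apply _ hι]
          exact congrFun (L.map_add (fun a => V (ι a)) fun a => W (ι a)) a
        · push Not at h
          simp [extendMap_apply_of_notMem _ _ h]
      map_smul' := fun c V => by
        ext1 j
        by_cases h : ∃ a, ι a = j
        · obtain ⟨a, rfl⟩ := h
          simp only [Pi.smul_apply, extendMap_apply _ hι]
          exact congrFun (L.map_smul c fun a => V (ι a)) a
        · push Not at h
          simp [extendMap_apply_of_notMem _ _ h] }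
  exact measurePreserving_of_sum_norm_sq E fun V => sum_norm_sq_extendMap hL hι V

theorem measurePreserving_comp_perm {d n : ℕ} (σ : Equiv.Perm (Fin n)) :
    MeasurePreserving (fun (V : Fin n → ESp d) j => V (σ j)) volume volume := by
  have h := volume_measurePreserving_piCongrLeft (fun _ : Fin n => ESp d) σ
  have e : (fun (V : Fin n → ESp d) j => V (σ j)) =
      (MeasurableEquiv.piCongrLeft (fun _ : Fin n => ESp d) σ).symm := rfl
  rw [e]
  exact h.symm

theorem measurePreserving_append {d m n : ℕ} :
    MeasurePreserving (fun p : (Fin m → ESp d) × (Fin n → ESp d) => Fin.append p.1 p.2)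
      (volume.prod volume) volume := by
  have h1 := (volume_measurePreserving_sumPiEquivProdPi_symm (fun _ : Fin m ⊕ Fin n => ESp d))
  have h2 := volume_measurePreserving_piCongrLeft (fun _ : Fin (m + n) => ESp d)
    (finSumFinEquiv (m := m) (n := n))
  suffices e : (fun p : (Fin m → ESp d) × (Fin n → ESp d) => Fin.append p.1 p.2) =
      (MeasurableEquiv.piCongrLeft (fun _ : Fin (m + n) => ESp d) finSumFinEquiv) ∘
        (MeasurableEquiv.sumPiEquivProdPi fun _ : Fin m ⊕ Fin n => ESp d).symm by
    rw [e]
    exact h2.comp h1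
  funext p j
  induction j using Fin.addCases with
  | left i =>
    rw [Fin.append_left, Function.comp_apply, ← finSumFinEquiv_apply_left,
      MeasurableEquiv.piCongrLeft_apply_apply]
    rfl
  | right i =>
    rw [Fin.append_right, Function.comp_apply, ← finSumFinEquiv_apply_right,
      MeasurableEquiv.piCongrLeft_apply_apply]
    rfl

/-- A jointly measurable random measure preserving map preserves the measure on average. -/
theorem measurePreserving_snd_skew {A X : Type*} [MeasurableSpace A] [MeasurableSpace X]
    {b : Measure A} [IsProbabilityMeasure b] {μ : Measure X} [SFinite μ] {G : A → X → X}
    (hG : Measurable fun p : A × X => G p.1 p.2) (h : ∀ a, MeasurePreserving (G a) μ μ) :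
    MeasurePreserving (fun p : A × X => G p.1 p.2) (b.prod μ) μ :=
  (measurePreserving_snd (μ := b) (ν := μ)).comp
    ((MeasurePreserving.id b).skew_product (g := G) hG (ae_of_all _ fun a => (h a).map_eq))

theorem margOf_add {d : ℕ} (s m : ℕ) (f : (Fin (s + m) → ESp d) → ℝ) (V : Fin s → ESp d) :
    margOf (s + m) s f V = ∫ w : Fin m → ESp d, f (Fin.append V w) := by
  have key : ∀ (m' : ℕ) (e : m' = m) (h : s + m = s + m'),
      ∫ w : Fin m' → ESp d, f (fun a => Fin.append V w (Fin.cast h a))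
        = ∫ w : Fin m → ESp d, f (Fin.append V w) := by
    rintro m' rfl h
    rfl
  rw [margOf, dif_pos (Nat.le_add_right s m)]
  exact key _ (by omega) _

theorem isL1Op_margOf {d s m : ℕ} :
    IsL1Op volume volume (margOf (d := d) (s + m) s) := by
  have h := (IsL1Op.integral_right (μ := (volume : Measure (Fin s → ESp d)))
    (ν := (volume : Measure (Fin m → ESp d)))).comp
      (IsL1Op.of_measurePreserving (measurePreserving_append (d := d) (m := s) (n := m)))
  have e : (margOf (d := d) (s + m) s) = fun f V => ∫ w : Fin m → ESp d, f (Fin.append V w) := by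
    ext f V
    exact margOf_add s m f V
  rw [e]
  exact h

theorem MeasureTheory.MeasurePreserving.integral_comp_of_aestronglyMeasurable {X Y : Type*}
    [MeasurableSpace X] [MeasurableSpace Y] {μ : Measure X} {ν : Measure Y} {G : X → Y}
    (hG : MeasurePreserving G μ ν) {f : Y → ℝ} (hf : AEStronglyMeasurable f ν) :
    ∫ x, f (G x) ∂μ = ∫ y, f y ∂ν := by
  have e := integral_map hG.measurable.aemeasurable (hG.map_eq.symm ▸ hf)
  rw [hG.map_eq] at e
  exact e.symm

section Collision

variable {d : ℕ} {S : ℕ → Type*} [∀ K, MeasurableSpace (S K)] {b : ∀ K, Measure (S K)}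
  {T : ∀ K, S K → (Fin K → ESp d) ≃ₗ[ℝ] (Fin K → ESp d)}

theorem measurable_extendMap_prod (hmeas : KacMeas d S T) {K N : ℕ} (ι : Fin K → Fin N) :
    Measurable fun p : S K × (Fin N → ESp d) => extendMap (⇑(T K p.1)) ι p.2 :=
  measurable_extendMap (G := fun p : S K × (Fin N → ESp d) => ⇑(T K p.1))
    ((hmeas K).comp ((measurable_fst.comp measurable_fst).prodMk measurable_snd)) measurable_snd

theorem omegaIdx_comp_perm_apply {K N : ℕ} {ι : Fin K → Fin N} (hι : Function.Injective ι)
    (σ : Equiv.Perm (Fin N)) {f : (Fin N → ESp d) → ℝ} (hf : SymFun f) (V : Fin N → ESp d) :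
    OmegaIdx b T K N (fun a => σ (ι a)) f V = OmegaIdx b T K N ι f (fun j => V (σ j)) := by
  have hσι : Function.Injective fun a => σ (ι a) := σ.injective.comp hι
  have key : ∀ ω, (fun j => extendMap (⇑(T K ω)) (fun a => σ (ι a)) V (σ j)) =
      extendMap (⇑(T K ω)) ι (fun j => V (σ j)) := by
    intro ω
    ext1 j
    by_cases h : ∃ a, ι a = j
    · obtain ⟨a, rfl⟩ := h
      rw [extendMap_apply _ hι]
      exact extendMap_apply _ hσι V a
    · push Not at h
      rw [extendMap_apply_of_notMem _ _ h, extendMap_apply_of_notMem]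
      exact fun a ha => h a (σ.injective ha)
  simp only [OmegaIdx, ← key, hf σ]

theorem symFun_masterGen (M : ℕ) (β : ℕ → ℝ) (N : ℕ) {f : (Fin N → ESp d) → ℝ}
    (hf : SymFun f) : SymFun (masterGen b T M β N f) := by
  intro σ V
  simp only [masterGen]
  congr 1
  refine Finset.sum_congr rfl fun K _ => ?_
  congr 1
  refine Fintype.sum_equiv (Equiv.arrowCongr (Equiv.refl (Fin K)) σ) _ _ fun ι => ?_
  have e : (Equiv.arrowCongr (Equiv.refl (Fin K)) σ) ι = fun a => σ (ι a) := rfl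
  rw [e]
  by_cases hι : Function.Injective ι
  · rw [if_pos hι, if_pos (show Function.Injective fun a => σ (ι a) from σ.injective.comp hι),
      omegaIdx_comp_perm_apply hι σ hf]
  · rw [if_neg hι, if_neg (show ¬ Function.Injective fun a => σ (ι a) from
      fun h => hι (Function.Injective.of_comp (f := σ) h))]

theorem symFun_masterSol (M : ℕ) (β : ℕ → ℝ) (N : ℕ) {f : (Fin N → ESp d) → ℝ}
    (hf : SymFun f) (t : ℝ) : SymFun (masterSol b T M β N f t) := by
  have h : ∀ n, SymFun ((masterGen b T M β N)^[n] f) := by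
    intro n
    induction n with
    | zero => exact hf
    | succ n ih =>
      rw [Function.iterate_succ_apply']
      exact symFun_masterGen M β N ih
  intro σ V
  simp only [masterSol, h _ σ V]

variable [∀ K, IsProbabilityMeasure (b K)]

theorem measurePreserving_collision (hmeas : KacMeas d S T) {K N : ℕ}
    (hT : ∀ ω V, ∑ i, ‖T K ω V i‖ ^ 2 = ∑ i, ‖V i‖ ^ 2)
    {ι : Fin K → Fin N} (hι : Function.Injective ι) :
    MeasurePreserving (fun p : S K × (Fin N → ESp d) => extendMap (⇑(T K p.1)) ι p.2)
      ((b K).prod volume) volume :=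
  measurePreserving_snd_skew (G := fun ω => extendMap (⇑(T K ω)) ι)
    (measurable_extendMap_prod hmeas ι)
    fun ω => measurePreserving_extendMap (T K ω).toLinearMap (hT ω) hι

theorem isL1Op_omegaIdx (hmeas : KacMeas d S T) {K N : ℕ}
    (hT : ∀ ω V, ∑ i, ‖T K ω V i‖ ^ 2 = ∑ i, ‖V i‖ ^ 2)
    {ι : Fin K → Fin N} (hι : Function.Injective ι) :
    IsL1Op volume volume (OmegaIdx b T K N ι) :=
  (IsL1Op.integral_left (μ := b K) (ν := (volume : Measure (Fin N → ESp d)))).comp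
    ((IsL1Op.of_measurePreserving (measurePreserving_collision (b := b) hmeas hT hι)).sub
      (IsL1Op.of_measurePreserving (measurePreserving_snd (μ := b K))))

theorem isL1Op_masterGen (hmeas : KacMeas d S T) {M : ℕ} (h1 : KacH1 d M S T) (β : ℕ → ℝ)
    (N : ℕ) : IsL1Op volume volume (masterGen b T M β N) := by
  refine (IsL1Op.sum _ fun K hK => (IsL1Op.sum _ fun ι _ => ?_).const_mul _).const_mul _
  rw [Finset.mem_Icc] at hK
  by_cases hι : Function.Injective ι
  · simp only [hι, if_true]
    exact isL1Op_omegaIdx hmeas (h1 K hK.1 hK.2) hι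
  · simp only [hι, if_false]
    exact IsL1Op.zero

/-- By (H3), relabelling the colliding particles does not change the collision operator. -/
theorem omegaIdx_relabel (hmeas : KacMeas d S T) {M : ℕ} (h1 : KacH1 d M S T)
    (h3 : KacH3 d M S b T) {K N : ℕ} (hK1 : 1 ≤ K) (hKM : K ≤ M)
    {ι : Fin K → Fin N} (hι : Function.Injective ι) (τ : Equiv.Perm (Fin K))
    {f : (Fin N → ESp d) → ℝ} (hf : Integrable f) :
    OmegaIdx b T K N (fun a => ι (τ a)) f =ᵐ[volume] OmegaIdx b T K N ι f := by
  have hιτ : Function.Injective fun a => ι (τ a) := hι.comp τ.injective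
  have hT := h1 K hK1 hKM
  have hmk : f =ᵐ[volume] hf.1.mk f := hf.1.ae_eq_mk
  have hgm : StronglyMeasurable (hf.1.mk f) := hf.1.stronglyMeasurable_mk
  set g := hf.1.mk f
  refine ((isL1Op_omegaIdx hmeas hT hιτ).congr hf hmk).trans
    (EventuallyEq.trans ?_ ((isL1Op_omegaIdx hmeas hT hι).congr hf hmk).symm)
  have hTm : ∀ W, Measurable fun ω => T K ω W := fun W =>
    (hmeas K).comp (measurable_id.prodMk measurable_const)
  have hperm : ∀ σ : Equiv.Perm (Fin K),
      Measurable (permAct σ : (Fin K → ESp d) → Fin K → ESp d) := fun σ =>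
    measurable_pi_iff.2 fun i => measurable_pi_apply _
  have hlaw : ∀ W, (b K).map (fun ω => permAct τ⁻¹ (T K ω (permAct τ W))) =
      (b K).map (fun ω => T K ω W) := by
    intro W
    have hm1 : Measurable fun ω => permAct τ⁻¹ (T K ω (permAct τ W)) := (hperm _).comp (hTm _)
    have := Measure.isProbabilityMeasure_map (μ := b K) hm1.aemeasurable
    have := Measure.isProbabilityMeasure_map (μ := b K) (hTm W).aemeasurable
    refine ext_of_forall_integral_eq_of_IsFiniteMeasure fun φ => ?_
    rw [integral_map hm1.aemeasurable φ.continuous.aestronglyMeasurable,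
      integral_map (hTm W).aemeasurable φ.continuous.aestronglyMeasurable]
    have := h3 K hK1 hKM τ⁻¹ φ φ.continuous W
    rwa [inv_inv] at this
  refine Eventually.of_forall fun V => ?_
  let U : (Fin K → ESp d) → ℝ := fun y => g (extendMap (fun _ => y) ι V) - g V
  have hU : StronglyMeasurable U :=
    (hgm.comp_measurable (measurable_extendMap (A := Fin K → ESp d) (G := fun y _ => y)
      (W := fun _ => V) measurable_fst measurable_const)).sub stronglyMeasurable_const
  have hext : ∀ ω, extendMap (⇑(T K ω)) (fun a => ι (τ a)) V =
      extendMap (fun _ => permAct τ⁻¹ (T K ω (permAct τ fun a => V (ι a)))) ι V := by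
    intro ω
    ext1 j
    by_cases h : ∃ a, ι a = j
    · obtain ⟨a, rfl⟩ := h
      rw [extendMap_apply _ hι]
      have := extendMap_apply (⇑(T K ω)) hιτ V (τ⁻¹ a)
      simp only [Equiv.Perm.inv_def, Equiv.apply_symm_apply] at this
      exact this
    · push Not at h
      rw [extendMap_apply_of_notMem _ _ h, extendMap_apply_of_notMem _ _ fun a => h (τ a)]
  have hL : OmegaIdx b T K N (fun a => ι (τ a)) g V =
      ∫ ω, U (permAct τ⁻¹ (T K ω (permAct τ fun a => V (ι a)))) ∂(b K) := by
    simp only [OmegaIdx, hext, U]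
  have hR : OmegaIdx b T K N ι g V = ∫ ω, U (T K ω fun a => V (ι a)) ∂(b K) := rfl
  rw [hL, hR, ← integral_map (φ := fun ω => permAct τ⁻¹ (T K ω (permAct τ fun a => V (ι a))))
      ((hperm _).comp (hTm _)).aemeasurable hU.aestronglyMeasurable, hlaw,
    integral_map (hTm _).aemeasurable hU.aestronglyMeasurable]

theorem collIdx_injective {s n r K : ℕ} (hK : K = n + r) {i : Fin n → Fin s}
    (hi : Function.Injective i) : Function.Injective (collIdx s n r K hK i) := by
  intro a a' h
  have h' := congrArg Fin.val h
  simp only [collIdx] at h'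
  by_cases h1 : (a : ℕ) < n <;> by_cases h2 : (a' : ℕ) < n
  · simp only [h1, h2, dif_pos, Fin.val_castLE] at h'
    have := hi (Fin.ext h')
    exact Fin.ext (Fin.mk.inj_iff.1 this)
  · simp only [h1, h2, dif_pos, Fin.val_castLE, dif_neg, not_false_eq_true] at h'
    have := (i ⟨a, h1⟩).isLt
    omega
  · simp only [h1, h2, dif_pos, Fin.val_castLE, dif_neg, not_false_eq_true] at h'
    have := (i ⟨a', h2⟩).isLt
    omega
  · simp only [h1, h2, dif_neg, not_false_eq_true] at h'
    exact Fin.ext (by omega)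

/-- Collisions among particles that are integrated out do not contribute. -/
theorem collOp_zero (hmeas : KacMeas d S T) {s r K : ℕ} (hK : K = 0 + r)
    (hT : ∀ ω V, ∑ i, ‖T K ω V i‖ ^ 2 = ∑ i, ‖V i‖ ^ 2)
    (i : Fin 0 → Fin s) {g : (Fin (s + r) → ESp d) → ℝ} (hg : Integrable g) :
    collOp b T s 0 r K hK i g =ᵐ[volume] 0 := by
  obtain rfl : K = r := by omega
  have hext : ∀ ω (V : Fin s → ESp d) (u : Fin K → ESp d),
      extendMap (⇑(T K ω)) (collIdx s 0 K K hK i) (Fin.append V u) =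
        Fin.append V (T K ω u) := by
    intro ω V u
    have hidx : ∀ a, collIdx s 0 K K hK i a = Fin.natAdd s a := fun a => by
      simp [collIdx, Fin.ext_iff]
    ext1 j
    induction j using Fin.addCases with
    | left c =>
      rw [extendMap_apply_of_notMem, Fin.append_left, Fin.append_left]
      intro a ha
      rw [hidx, Fin.ext_iff] at ha
      have := c.isLt
      simp at ha
      omega
    | right c =>
      rw [← hidx c, extendMap_apply _ (collIdx_injective hK fun a => a.elim0)]
      simp only [hidx, Fin.append_right]
  have hG : MeasurePreserving (fun p : S K × (Fin K → ESp d) => T K p.1 p.2)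
      ((b K).prod volume) volume :=
    measurePreserving_snd_skew (G := fun ω => ⇑(T K ω)) (hmeas K)
      fun ω => measurePreserving_of_sum_norm_sq (T K ω).toLinearMap (hT ω)
  have hfib := (measurePreserving_append.integrable_comp_of_integrable hg).prod_right_ae
  filter_upwards [hfib] with V hV
  have hV' : Integrable (fun u : Fin K → ESp d => g (Fin.append V u)) := hV
  simp only [collOp, hext, Pi.zero_apply]
  have hs := measurePreserving_snd (μ := b K) (ν := (volume : Measure (Fin K → ESp d)))
  refine (integral_sub (hG.integrable_comp_of_integrable hV')
    (hs.integrable_comp_of_integrable hV')).trans ?_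
  refine sub_eq_zero.2 ((hG.integral_comp_of_aestronglyMeasurable hV'.1).trans
    (hs.integral_comp_of_aestronglyMeasurable hV'.1).symm)

/-- The marginal of a collision involving the first integrated-out particles. -/
theorem margOf_omegaIdx_collIdx (hmeas : KacMeas d S T) {s n r q K : ℕ} (hK : K = n + r)
    (hT : ∀ ω V, ∑ i, ‖T K ω V i‖ ^ 2 = ∑ i, ‖V i‖ ^ 2)
    {i : Fin n → Fin s} (hi : Function.Injective i)
    {f : (Fin (s + (r + q)) → ESp d) → ℝ} (hf : Integrable f) :
    margOf (s + (r + q)) s (OmegaIdx b T K (s + (r + q))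
        (fun a => Fin.castLE (by omega) (collIdx s n r K hK i a)) f) =ᵐ[volume]
      collOp b T s n r K hK i (margOf (s + (r + q)) (s + r) f) := by
  have hc := collIdx_injective hK hi
  have hι : Function.Injective fun a =>
      (Fin.castLE (by omega) (collIdx s n r K hK i a) : Fin (s + (r + q))) :=
    (Fin.castLE_injective _).comp hc
  have happ : ∀ (V : Fin s → ESp d) (u : Fin r → ESp d) (x : Fin q → ESp d),
      Fin.append V (Fin.append u x) = fun j => Fin.append (Fin.append V u) x
        (Fin.cast (by omega) j) := fun V u x => by
    rw [Fin.append_assoc]; rfl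
  have hmarg : ∀ W : Fin (s + r) → ESp d, margOf (s + (r + q)) (s + r) f W =
      ∫ x : Fin q → ESp d, f (fun j => Fin.append W x (Fin.cast (by omega) j)) := by
    intro W
    have key : ∀ (N : ℕ) (e : N = s + r + q) (f : (Fin N → ESp d) → ℝ),
        margOf N (s + r) f W = ∫ x : Fin q → ESp d,
          f (fun j => Fin.append W x (Fin.cast e j)) := by
      rintro N rfl f
      exact margOf_add _ _ _ _
    exact key _ _ f
  have hext : ∀ ω (V : Fin s → ESp d) (u : Fin r → ESp d) (x : Fin q → ESp d),
      extendMap (⇑(T K ω)) (fun a => Fin.castLE (by omega) (collIdx s n r K hK i a))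
        (Fin.append V (Fin.append u x)) = fun j => Fin.append
          (extendMap (⇑(T K ω)) (collIdx s n r K hK i) (Fin.append V u)) x
          (Fin.cast (by omega) j) := by
    intro ω V u x
    rw [happ]
    ext1 j
    obtain ⟨j, rfl⟩ : ∃ j' : Fin (s + r + q), j = Fin.cast (by omega) j' :=
      ⟨Fin.cast (by omega) j, rfl⟩
    have hcast : ∀ a : Fin (s + r), (Fin.castLE (by omega) a : Fin (s + (r + q))) =
      Fin.cast (by omega) (Fin.castAdd q a) := fun a => rfl
    simp only [hcast] at hι ⊢
    induction j using Fin.addCases with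
    | left c =>
      simp only [Fin.cast_cast, Fin.cast_eq_self, Fin.append_left]
      by_cases h : ∃ a, collIdx s n r K hK i a = c
      · obtain ⟨a, rfl⟩ := h
        rw [extendMap_apply _ hc]
        refine (extendMap_apply _ hι _ a).trans ?_
        simp
      · push Not at h
        rw [extendMap_apply_of_notMem _ _ h, extendMap_apply_of_notMem]
        · simp
        · intro a ha
          exact h a (Fin.castAdd_injective _ _ (Fin.cast_injective _ ha))
    | right c =>
      rw [extendMap_apply_of_notMem]
      · simp
      · intro a ha
        have := congrArg Fin.val ha
        simp at this
        have := (collIdx s n r K hK i a).isLt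
        omega
  have hQ : MeasurePreserving
      (fun p : (Fin s → ESp d) × (S K × (Fin (r + q) → ESp d)) => (p.2.1, Fin.append p.1 p.2.2))
      (volume.prod ((b K).prod volume)) ((b K).prod volume) :=
    ((MeasurePreserving.id (b K)).prod (measurePreserving_append (d := d))).comp
      ((measurePreserving_prodAssoc (b K) volume volume).comp
        ((Measure.measurePreserving_swap.prod (MeasurePreserving.id volume)).comp
          (measurePreserving_prodAssoc (volume : Measure (Fin s → ESp d)) (b K)
            (volume : Measure (Fin (r + q) → ESp d))).symm))
  have hR : MeasurePreserving
      (fun p : (S K × (Fin r → ESp d)) × (Fin q → ESp d) => (p.1.1, Fin.append p.1.2 p.2))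
      (((b K).prod volume).prod volume) ((b K).prod volume) :=
    ((MeasurePreserving.id (b K)).prod (measurePreserving_append (d := d))).comp
      (measurePreserving_prodAssoc (b K) volume volume)
  have hG := measurePreserving_collision (b := b) hmeas hT hι
  have hS := measurePreserving_snd (μ := b K)
    (ν := (volume : Measure (Fin (s + (r + q)) → ESp d)))
  filter_upwards [((hG.comp hQ).integrable_comp_of_integrable hf).prod_right_ae,
    ((hS.comp hQ).integrable_comp_of_integrable hf).prod_right_ae] with V hV1 hV2
  have hV := hV1.sub hV2
  rw [margOf_add, collOp]
  refine (integral_prod_symm _ hV).symm.trans ?_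
  rw [← hR.integral_comp_of_aestronglyMeasurable hV.1]
  refine (integral_prod _ (hR.integrable_comp_of_integrable hV)).trans ?_
  refine integral_congr_ae ?_
  filter_upwards [(hR.integrable_comp_of_integrable hV1).prod_right_ae,
    (hR.integrable_comp_of_integrable hV2).prod_right_ae] with p hp1 hp2
  refine (integral_sub hp1 hp2).trans ?_
  simp only [Function.comp_apply, hext, hmarg]
  simp only [happ]

end Collision

section Counting

/-- The colliding particles among the first `s`. -/
def keptIdx {K : ℕ} (s m : ℕ) (ι : Fin K → Fin (s + m)) : Finset (Fin s) :=
  univ.filter fun c => ∃ a, ι a = Fin.castAdd m c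

/-- The colliding particles among the last `m`. -/
def tracedIdx {K : ℕ} (s m : ℕ) (ι : Fin K → Fin (s + m)) : Finset (Fin m) :=
  univ.filter fun c => ∃ a, ι a = Fin.natAdd s c

/-- A permutation of the last `m` labels, acting on all `s + m` labels. -/
def tailPerm (s : ℕ) {m : ℕ} (ρ : Equiv.Perm (Fin m)) : Equiv.Perm (Fin (s + m)) :=
  finSumFinEquiv.symm.trans ((Equiv.sumCongr (Equiv.refl (Fin s)) ρ).trans finSumFinEquiv)

variable {s m K : ℕ}

@[simp] theorem tailPerm_castAdd (ρ : Equiv.Perm (Fin m)) (c : Fin s) :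
    tailPerm s ρ (Fin.castAdd m c) = Fin.castAdd m c := by
  simp [tailPerm]

@[simp] theorem tailPerm_natAdd (ρ : Equiv.Perm (Fin m)) (c : Fin m) :
    tailPerm s ρ (Fin.natAdd s c) = Fin.natAdd s (ρ c) := by
  simp [tailPerm]

theorem image_eq_map_disjSum (ι : Fin K → Fin (s + m)) :
    univ.image ι = ((keptIdx s m ι).disjSum (tracedIdx s m ι)).map
      finSumFinEquiv.toEmbedding := by
  ext j
  induction j using Fin.addCases with
  | left c =>
    simp [keptIdx, tracedIdx, Finset.mem_map_equiv]
  | right c =>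
    simp [keptIdx, tracedIdx, Finset.mem_map_equiv]

theorem card_keptIdx_add_card_tracedIdx {ι : Fin K → Fin (s + m)} (hι : Function.Injective ι) :
    (keptIdx s m ι).card + (tracedIdx s m ι).card = K := by
  have h := congrArg Finset.card (image_eq_map_disjSum ι)
  rw [Finset.card_image_of_injective _ hι, Finset.card_map, Finset.card_disjSum] at h
  simpa using h.symm

theorem exists_perm_comp_of_range_eq {α β : Type*} {f g : α → β} (hf : Function.Injective f)
    (hg : Function.Injective g) (h : Set.range f = Set.range g) :
    ∃ τ : Equiv.Perm α, ∀ a, f a = g (τ a) := by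
  refine ⟨(Equiv.ofInjective f hf).trans ((Equiv.setCongr h).trans (Equiv.ofInjective g hg).symm),
    fun a => ?_⟩
  simp [Equiv.apply_ofInjective_symm]

theorem exists_perm_comp_of_kept_traced {ι ι' : Fin K → Fin (s + m)} (hι : Function.Injective ι)
    (hι' : Function.Injective ι') (hk : keptIdx s m ι = keptIdx s m ι')
    (ht : tracedIdx s m ι = tracedIdx s m ι') :
    ∃ τ : Equiv.Perm (Fin K), ∀ a, ι a = ι' (τ a) := by
  refine exists_perm_comp_of_range_eq hι hι' ?_
  have h : univ.image ι = univ.image ι' := by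
    rw [image_eq_map_disjSum, image_eq_map_disjSum, hk, ht]
  simpa using congrArg (fun A : Finset (Fin (s + m)) => (A : Set (Fin (s + m)))) h

/-- Two collisions with the same kept particles differ by relabelling the traced particles and
reordering the colliding ones. -/
theorem exists_tailPerm_comp {ι ι' : Fin K → Fin (s + m)} (hι : Function.Injective ι)
    (hι' : Function.Injective ι') (hk : keptIdx s m ι = keptIdx s m ι') :
    ∃ (ρ : Equiv.Perm (Fin m)) (τ : Equiv.Perm (Fin K)),
      ∀ a, ι a = tailPerm s ρ (ι' (τ a)) := by
  have hc : (tracedIdx s m ι').card = (tracedIdx s m ι).card := by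
    have h1 := card_keptIdx_add_card_tracedIdx hι
    have h2 := card_keptIdx_add_card_tracedIdx hι'
    rw [hk] at h1
    omega
  let e : {x // x ∈ tracedIdx s m ι'} ≃ {x // x ∈ tracedIdx s m ι} := Finset.equivOfCardEq hc
  let ρ : Equiv.Perm (Fin m) := e.extendSubtype
  have hρ : ∀ x, ρ x ∈ tracedIdx s m ι ↔ x ∈ tracedIdx s m ι' := fun x => by
    by_cases hx : x ∈ tracedIdx s m ι'
    · exact iff_of_true (e.extendSubtype_mem x hx) hx
    · exact iff_of_false (e.extendSubtype_not_mem x hx) hx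
  have hinj : Function.Injective fun a => tailPerm s ρ (ι' a) := (tailPerm s ρ).injective.comp hι'
  refine ⟨ρ, exists_perm_comp_of_kept_traced hι hinj ?_ ?_⟩
  · rw [hk]
    ext c
    simp only [keptIdx, mem_filter, mem_univ, true_and]
    refine exists_congr fun a => ?_
    rw [← (tailPerm s ρ).injective.eq_iff, tailPerm_castAdd]
  · ext c
    obtain ⟨x, rfl⟩ := ρ.surjective c
    rw [hρ]
    simp only [tracedIdx, mem_filter, mem_univ, true_and]
    refine exists_congr fun a => ?_
    rw [← (tailPerm s ρ).injective.eq_iff, tailPerm_natAdd]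

theorem exists_injective_kept_traced (B : Finset (Fin s)) (L : Finset (Fin m))
    (h : B.card + L.card = K) :
    ∃ ι : Fin K → Fin (s + m), Function.Injective ι ∧ keptIdx s m ι = B ∧
      tracedIdx s m ι = L := by
  let A : Finset (Fin (s + m)) := (B.disjSum L).map finSumFinEquiv.toEmbedding
  have hA : A.card = K := by rw [Finset.card_map, Finset.card_disjSum, h]
  have hr : ∀ j, (∃ a, A.orderEmbOfFin hA a = j) ↔ j ∈ A := fun j => by
    have := Finset.range_orderEmbOfFin A hA
    rw [← Set.mem_range, this, Finset.mem_coe]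
  refine ⟨A.orderEmbOfFin hA, (A.orderEmbOfFin hA).injective, ?_, ?_⟩
  · ext c
    simp [keptIdx, hr, A, Finset.mem_map_equiv]
  · ext c
    simp [tracedIdx, hr, A, Finset.mem_map_equiv]

theorem card_injective_kept {k : ℕ} (B : Finset (Fin s)) (hK : k + B.card = K) :
    (univ.filter fun ι : Fin K → Fin (s + m) =>
      Function.Injective ι ∧ keptIdx s m ι = B).card = K.factorial * m.choose k := by
  rw [Finset.card_eq_sum_card_fiberwise (f := tracedIdx s m)
    (t := powersetCard k (univ : Finset (Fin m)))]
  · have hfib : ∀ L ∈ powersetCard k (univ : Finset (Fin m)),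
        ((univ.filter fun ι : Fin K → Fin (s + m) =>
          Function.Injective ι ∧ keptIdx s m ι = B).filter fun ι => tracedIdx s m ι = L).card =
          K.factorial := by
      intro L hL
      rw [mem_powersetCard] at hL
      obtain ⟨ι₀, h0, hB, hL'⟩ := exists_injective_kept_traced (K := K) B L (by omega)
      have hcard : (univ : Finset (Equiv.Perm (Fin K))).card = K.factorial := by
        rw [Finset.card_univ, Fintype.card_perm, Fintype.card_fin]
      rw [← hcard]
      symm
      refine Finset.card_bij (fun τ _ a => ι₀ (τ a)) ?_ ?_ ?_
      · intro τ _
        simp only [mem_filter, mem_univ, true_and]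
        refine ⟨⟨h0.comp τ.injective, ?_⟩, ?_⟩
        · rw [← hB]
          ext c
          simp only [keptIdx, mem_filter, mem_univ, true_and]
          exact (τ.surjective.exists (p := fun a => ι₀ a = Fin.castAdd m c)).symm
        · rw [← hL']
          ext c
          simp only [tracedIdx, mem_filter, mem_univ, true_and]
          exact (τ.surjective.exists (p := fun a => ι₀ a = Fin.natAdd s c)).symm
      · intro τ _ τ' _ h
        ext1 a
        exact h0 (congrFun h a)
      · intro ι hι
        simp only [mem_filter, mem_univ, true_and] at hι
        obtain ⟨τ, hτ⟩ := exists_perm_comp_of_kept_traced hι.1.1 h0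
          (hι.1.2.trans hB.symm) (hι.2.trans hL'.symm)
        exact ⟨τ, mem_univ _, (funext hτ).symm⟩
    rw [Finset.sum_congr rfl hfib, Finset.sum_const, card_powersetCard]
    simp [mul_comm]
  · intro ι hι
    simp only [coe_filter, mem_univ, true_and, Set.mem_ofPred_eq] at hι
    have := card_keptIdx_add_card_tracedIdx hι.1
    rw [hι.2] at this
    simp only [mem_coe, mem_powersetCard, subset_univ, true_and]
    omega

/-- Summing over collisions a quantity depending only on the kept particles. -/
theorem sum_injective_eq_sum_antidiagonal (X : (Fin K → Fin (s + m)) → ℝ)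
    (Y : ℕ → ∀ n : ℕ, (Fin n → Fin s) → ℝ)
    (hXY : ∀ ι, Function.Injective ι → ∀ k n, k + n = K → ∀ i : Fin n → Fin s,
      StrictMono i → keptIdx s m ι = univ.image i → X ι = Y k n i) :
    ∑ ι : Fin K → Fin (s + m), (if Function.Injective ι then X ι else 0) =
      ∑ p ∈ antidiagonal K, ((K.factorial * m.choose p.1 : ℕ) : ℝ) *
        ∑ i : Fin p.2 → Fin s, (if StrictMono i then Y p.1 p.2 i else 0) := by
  have hpt : ∀ ι : Fin K → Fin (s + m), (if Function.Injective ι then X ι else 0) =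
      ∑ p ∈ antidiagonal K, ∑ i : Fin p.2 → Fin s,
        (if StrictMono i then
          (if Function.Injective ι ∧ keptIdx s m ι = univ.image i then Y p.1 p.2 i else 0) else 0) := by
    intro ι
    by_cases hι : Function.Injective ι
    · have hcard := card_keptIdx_add_card_tracedIdx hι
      rw [if_pos hι, Finset.sum_eq_single ((tracedIdx s m ι).card, (keptIdx s m ι).card)]
      · let i₀ := (keptIdx s m ι).orderEmbOfFin rfl
        have h0 : keptIdx s m ι = univ.image i₀ := by
          rw [← Finset.coe_inj, coe_image, coe_univ, Set.image_univ, range_orderEmbOfFin]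
        rw [Finset.sum_eq_single (i₀ : Fin (keptIdx s m ι).card → Fin s)]
        · rw [if_pos i₀.strictMono, if_pos ⟨hι, h0⟩]
          exact hXY ι hι _ _ (by omega) _ i₀.strictMono h0
        · intro i _ hi
          split_ifs with h1 h2
          · refine absurd ?_ hi
            exact Finset.orderEmbOfFin_unique rfl
              (fun x => h2.2 ▸ mem_image_of_mem i (mem_univ x)) h1
          · rfl
          · rfl
        · exact fun h => absurd (mem_univ _) h
      · rintro ⟨k, n⟩ hp hne
        rw [HasAntidiagonal.mem_antidiagonal] at hp
        refine Finset.sum_eq_zero fun i _ => ?_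
        split_ifs with h1 h2
        · have : (keptIdx s m ι).card = n := by
            rw [h2.2, card_image_of_injective _ h1.injective, card_univ, Fintype.card_fin]
          refine absurd ?_ hne
          rw [Prod.mk.injEq]
          simp only at hp
          omega
        · rfl
        · rfl
      · intro h
        refine absurd ?_ h
        rw [HasAntidiagonal.mem_antidiagonal]
        omega
    · rw [if_neg hι]
      symm
      refine Finset.sum_eq_zero fun p _ => Finset.sum_eq_zero fun i _ => ?_
      simp [hι]
  rw [Finset.sum_congr rfl fun ι _ => hpt ι, Finset.sum_comm]
  refine Finset.sum_congr rfl fun p hp => ?_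
  rw [HasAntidiagonal.mem_antidiagonal] at hp
  rw [Finset.sum_comm, Finset.mul_sum]
  refine Finset.sum_congr rfl fun i _ => ?_
  by_cases hi : StrictMono i
  · simp only [if_pos hi]
    rw [← Finset.sum_filter, Finset.sum_const,
      card_injective_kept (k := p.1) (univ.image i)
        (by rw [card_image_of_injective _ hi.injective, card_univ, Fintype.card_fin, hp]),
      nsmul_eq_mul]
  · simp [hi]

end Counting

section Hierarchy

variable {d : ℕ} {S : ℕ → Type*} [∀ K, MeasurableSpace (S K)] {b : ∀ K, Measure (S K)}
  {T : ∀ K, S K → (Fin K → ESp d) ≃ₗ[ℝ] (Fin K → ESp d)}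

theorem append_comp_tailPerm {α : Type*} {s m : ℕ} (ρ : Equiv.Perm (Fin m)) (V : Fin s → α)
    (w : Fin m → α) :
    (fun j => Fin.append V w (tailPerm s ρ j)) = Fin.append V fun c => w (ρ c) := by
  ext1 j
  induction j using Fin.addCases with
  | left c => simp
  | right c => simp

/-- Relabelling traced particles does not change the marginal of a collision. -/
theorem margOf_omegaIdx_tailPerm {s m K : ℕ} {ι : Fin K → Fin (s + m)}
    (hι : Function.Injective ι) (ρ : Equiv.Perm (Fin m)) {f : (Fin (s + m) → ESp d) → ℝ}
    (hf : SymFun f) :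
    margOf (s + m) s (OmegaIdx b T K (s + m) (fun a => tailPerm s ρ (ι a)) f) =
      margOf (s + m) s (OmegaIdx b T K (s + m) ι f) := by
  ext V
  rw [margOf_add, margOf_add]
  simp only [omegaIdx_comp_perm_apply hι (tailPerm s ρ) hf, append_comp_tailPerm]
  exact (measurePreserving_comp_perm ρ).integral_comp
    (MeasurableEquiv.piCongrLeft (fun _ : Fin m => ESp d) ρ).symm.measurableEmbedding
    fun w => OmegaIdx b T K (s + m) ι f (Fin.append V w)

theorem integrable_margOf {N j : ℕ} (h : j ≤ N) {f : (Fin N → ESp d) → ℝ} (hf : Integrable f) :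
    Integrable (margOf N j f) := by
  obtain ⟨m, rfl⟩ := Nat.exists_eq_add_of_le h
  exact isL1Op_margOf.integrable hf

theorem margOf_zero (N j : ℕ) : margOf N j (fun _ : Fin N → ESp d => (0 : ℝ)) = 0 := by
  ext V
  rw [margOf]
  split_ifs <;> simp

theorem keptIdx_castLE_collIdx {s n r q K : ℕ} (hK : K = n + r) (i : Fin n → Fin s) :
    keptIdx s (r + q) (fun a => Fin.castLE (by omega) (collIdx s n r K hK i a)) =
      univ.image i := by
  ext c
  simp only [keptIdx, mem_filter, mem_univ, true_and, mem_image, Fin.ext_iff, Fin.val_castLE,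
    Fin.val_castAdd]
  constructor
  · rintro ⟨a, ha⟩
    by_cases h : (a : ℕ) < n
    · exact ⟨⟨a, h⟩, by simpa [collIdx, h] using ha⟩
    · simp only [collIdx, h, dif_neg, not_false_eq_true] at ha
      have := c.isLt
      omega
  · rintro ⟨a, ha⟩
    exact ⟨⟨a, by omega⟩, by simpa [collIdx] using ha⟩

variable [∀ K, IsProbabilityMeasure (b K)]

theorem margOf_omegaIdx (hmeas : KacMeas d S T) {M : ℕ} (h1 : KacH1 d M S T)
    (h3 : KacH3 d M S b T) {s m k n : ℕ} (hK1 : 1 ≤ k + n) (hKM : k + n ≤ M)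
    {ι : Fin (k + n) → Fin (s + m)} (hι : Function.Injective ι) {i : Fin n → Fin s}
    (hi : StrictMono i) (hk : keptIdx s m ι = univ.image i)
    {f : (Fin (s + m) → ESp d) → ℝ} (hf : Integrable f) (hsym : SymFun f) :
    margOf (s + m) s (OmegaIdx b T (k + n) (s + m) ι f) =ᵐ[volume]
      collOp b T s n k (k + n) (by omega) i (margOf (s + m) (s + k) f) := by
  have hcard := card_keptIdx_add_card_tracedIdx hι
  rw [hk, card_image_of_injective _ hi.injective, card_univ, Fintype.card_fin] at hcard
  have hle : (tracedIdx s m ι).card ≤ m := by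
    simpa using Finset.card_le_univ (tracedIdx s m ι)
  obtain ⟨q, rfl⟩ : ∃ q, m = k + q := ⟨m - k, by omega⟩
  have hK : k + n = n + k := Nat.add_comm k n
  have hsk : s + k ≤ s + (k + q) := by omega
  have h0 : Function.Injective fun a =>
      (Fin.castLE hsk (collIdx s n k (k + n) hK i a) : Fin (s + (k + q))) :=
    (Fin.castLE_injective _).comp (collIdx_injective hK hi.injective)
  obtain ⟨ρ, τ, hτ⟩ := exists_tailPerm_comp hι h0
    (hk.trans (keptIdx_castLE_collIdx hK i).symm)
  obtain rfl := funext hτ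
  have hρ := (tailPerm s ρ).injective.comp h0
  refine (isL1Op_margOf.congr ((isL1Op_omegaIdx hmeas (h1 _ hK1 hKM) hι).integrable hf)
    (omegaIdx_relabel hmeas h1 h3 hK1 hKM hρ τ hf)).trans ?_
  refine (EventuallyEq.of_eq (margOf_omegaIdx_tailPerm h0 ρ hsym)).trans ?_
  exact margOf_omegaIdx_collIdx hmeas hK (h1 _ hK1 hKM) hi.injective hf

theorem sum_Icc_sum_antidiagonal (M : ℕ) (Z : ℕ → ℕ → ℝ) (hZ : ∀ k, 1 ≤ k → k ≤ M → Z k 0 = 0) :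
    ∑ K ∈ Icc 1 M, ∑ p ∈ antidiagonal K, Z p.1 p.2 =
      ∑ k ∈ range M, ∑ n ∈ Icc 1 (M - k), Z k n := by
  have h : ∀ K ∈ Icc 1 M, ∑ p ∈ antidiagonal K, Z p.1 p.2 =
      ∑ k ∈ range K, Z k (K - k) := by
    intro K hK
    rw [mem_Icc] at hK
    rw [Finset.Nat.sum_antidiagonal_eq_sum_range_succ Z K, Finset.sum_range_succ, Nat.sub_self,
      hZ K hK.1 hK.2, add_zero]
  rw [Finset.sum_congr rfl h, Finset.sum_sigma', Finset.sum_sigma']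
  refine Finset.sum_bij' (fun x _ => ⟨x.2, x.1 - x.2⟩) (fun x _ => ⟨x.1 + x.2, x.1⟩) ?_ ?_ ?_ ?_ ?_
  · rintro ⟨K, k⟩ h
    simp only [mem_sigma, mem_Icc, mem_range] at h ⊢
    omega
  · rintro ⟨k, n⟩ h
    simp only [mem_sigma, mem_Icc, mem_range] at h ⊢
    omega
  · rintro ⟨K, k⟩ h
    simp only [mem_sigma, mem_Icc, mem_range] at h
    simp only [Sigma.mk.injEq, heq_eq_eq, and_true]
    omega
  · rintro ⟨k, n⟩ h
    simp
  · rintro ⟨K, k⟩ h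
    rfl

theorem margOf_masterGen (hmeas : KacMeas d S T) {M : ℕ} (h1 : KacH1 d M S T) (β : ℕ → ℝ)
    {s m : ℕ} {f : (Fin (s + m) → ESp d) → ℝ} (hf : Integrable f) :
    margOf (s + m) s (masterGen b T M β (s + m) f) =ᵐ[volume] fun V =>
      ((s + m : ℕ) : ℝ) * ∑ K ∈ Icc 1 M,
        β K * (1 / ((K.factorial : ℝ) * ((s + m).choose K : ℝ))) *
          ∑ ι : Fin K → Fin (s + m), (if Function.Injective ι then
            margOf (s + m) s (OmegaIdx b T K (s + m) ι f) V else 0) := by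
  have hP : IsL1Op volume volume (margOf (d := d) (s + m) s) := isL1Op_margOf
  have hInt : ∀ K ∈ Icc 1 M, ∀ ι : Fin K → Fin (s + m), Integrable fun V =>
      if Function.Injective ι then OmegaIdx b T K (s + m) ι f V else 0 := by
    intro K hK ι
    rw [mem_Icc] at hK
    by_cases hι : Function.Injective ι
    · simp only [hι, if_true]
      exact (isL1Op_omegaIdx hmeas (h1 K hK.1 hK.2) hι).integrable hf
    · simp only [hι, if_false]
      exact integrable_zero _ _ _
  have hsum : ∀ K ∈ Icc 1 M, Integrable fun V => ∑ ι : Fin K → Fin (s + m),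
      (if Function.Injective ι then OmegaIdx b T K (s + m) ι f V else 0) := fun K hK =>
    integrable_finsetSum _ fun ι _ => hInt K hK ι
  have hK : ∀ K ∈ Icc 1 M, margOf (s + m) s (fun V =>
      β K * (1 / ((K.factorial : ℝ) * ((s + m).choose K : ℝ))) *
        ∑ ι : Fin K → Fin (s + m),
          (if Function.Injective ι then OmegaIdx b T K (s + m) ι f V else 0)) =ᵐ[volume] fun V =>
      β K * (1 / ((K.factorial : ℝ) * ((s + m).choose K : ℝ))) *
        ∑ ι : Fin K → Fin (s + m), (if Function.Injective ι then
          margOf (s + m) s (OmegaIdx b T K (s + m) ι f) V else 0) := by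
    intro K hK
    refine (hP.map_const_mul (hsum K hK) _).trans ?_
    filter_upwards [hP.map_sum univ fun ι _ => hInt K hK ι] with V hV
    rw [hV]
    congr 1
    refine Finset.sum_congr rfl fun ι _ => ?_
    by_cases hι : Function.Injective ι
    · simp only [hι, if_true]
    · simp only [hι, if_false, margOf_zero]
      rfl
  refine (hP.map_const_mul (integrable_finsetSum _ fun K hK => (hsum K hK).const_mul _) _).trans ?_
  filter_upwards [hP.map_sum (Icc 1 M) fun K hK => (hsum K hK).const_mul _,
    (ae_ball_iff (Finset.countable_toSet (Icc 1 M))).2 hK] with V hV hVK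
  rw [hV, Finset.sum_congr rfl hVK]

/-- Tracing out the generator yields the hierarchy operators. -/
theorem margOf_masterGen_eq_sum_bbgkyC (hmeas : KacMeas d S T) {M : ℕ} (h1 : KacH1 d M S T)
    (h3 : KacH3 d M S b T) (β : ℕ → ℝ) {s m : ℕ}
    {f : (Fin (s + m) → ESp d) → ℝ} (hf : Integrable f) (hsym : SymFun f) :
    margOf (s + m) s (masterGen b T M β (s + m) f) =ᵐ[volume] fun V =>
      ∑ k ∈ range M, bbgkyC b T M β (s + m) s k (margOf (s + m) (s + k) f) V := by
  have hcoll : ∀ᵐ V : Fin s → ESp d, ∀ k n : ℕ, ∀ hK1 : 1 ≤ k + n, ∀ hKM : k + n ≤ M,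
      ∀ (ι : Fin (k + n) → Fin (s + m)) (hι : Function.Injective ι) (i : Fin n → Fin s)
        (hi : StrictMono i) (hk : keptIdx s m ι = univ.image i),
      margOf (s + m) s (OmegaIdx b T (k + n) (s + m) ι f) V =
        collOp b T s n k (k + n) (by omega) i (margOf (s + m) (s + k) f) V := by
    simp only [ae_all_iff]
    intro k n hK1 hKM ι hι i hi hk
    exact margOf_omegaIdx hmeas h1 h3 hK1 hKM hι hi hk hf hsym
  have hzero : ∀ᵐ V : Fin s → ESp d, ∀ k : ℕ, ∀ hk1 : 1 ≤ k, ∀ hkM : k ≤ M, ∀ hkm : k ≤ m,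
      ∀ i : Fin 0 → Fin s,
      collOp b T s 0 k (k + 0) (by omega) i (margOf (s + m) (s + k) f) V = 0 := by
    simp only [ae_all_iff]
    intro k hk1 hkM hkm i
    exact collOp_zero hmeas (by omega) (h1 k hk1 hkM) i (integrable_margOf (by omega) hf)
  filter_upwards [margOf_masterGen (b := b) hmeas h1 β hf, hcoll, hzero] with V hV hcoll hzero
  let Y : ∀ k n : ℕ, (Fin n → Fin s) → ℝ := fun k n i =>
    collOp b T s n k (k + n) (by omega) i (margOf (s + m) (s + k) f) V
  let Z : ℕ → ℕ → ℝ := fun k n =>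
    β (k + n) * (((s + m : ℕ) : ℝ) / ((s + m).choose (k + n) : ℝ)) * (m.choose k : ℝ) *
      ∑ i : Fin n → Fin s, (if StrictMono i then Y k n i else 0)
  have hZ : ∀ k, 1 ≤ k → k ≤ M → Z k 0 = 0 := by
    intro k hk1 hkM
    by_cases hkm : k ≤ m
    · have : ∀ i, Y k 0 i = 0 := hzero k hk1 hkM hkm
      simp [Z, this]
    · simp [Z, Nat.choose_eq_zero_of_lt (not_le.1 hkm)]
  rw [hV, Finset.mul_sum]
  trans ∑ K ∈ Icc 1 M, ∑ p ∈ antidiagonal K, Z p.1 p.2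
  · refine Finset.sum_congr rfl fun K hK => ?_
    rw [mem_Icc] at hK
    rw [sum_injective_eq_sum_antidiagonal _ Y ?_, Finset.mul_sum, Finset.mul_sum]
    · refine Finset.sum_congr rfl fun p hp => ?_
      rw [HasAntidiagonal.mem_antidiagonal] at hp
      have hfac : (K.factorial : ℝ) ≠ 0 := by exact_mod_cast K.factorial_ne_zero
      simp only [Z, hp]
      push_cast
      field_simp
    · rintro ι hι k n rfl i hi hk
      exact hcoll k n hK.1 hK.2 ι hι i hi hk
  · rw [sum_Icc_sum_antidiagonal M Z hZ]
    refine Finset.sum_congr rfl fun k hk => ?_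
    rw [bbgkyC]
    split_ifs with h
    · simp only [Nat.add_sub_cancel_left]
      rfl
    · refine Finset.sum_eq_zero fun n _ => ?_
      simp [Z, Nat.choose_eq_zero_of_lt (show m < k by omega)]

end Hierarchy

/-- **The marginals of the Master equation solve the BBGKY hierarchy** (Lemma 6.3 of the
paper). For `N ≥ M` and `f_N(t) = e^{tΩ} f_{N,0}` with symmetric integrable initial datum,
for every `1 ≤ s ≤ N` and every `t`, the marginals satisfy
`∂_t f_N^(s)(t) = Σ_{k=0}^{M−1} C^N_{s,s+k} f_N^(s+k)(t)` in `L¹_sym(ℝ^{ds})`. -/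
theorem stmt7 (d M : ℕ) (S : ℕ → Type*) [∀ K, MeasurableSpace (S K)]
    (b : ∀ K, Measure (S K)) [∀ K, IsProbabilityMeasure (b K)]
    (T : ∀ K, S K → (Fin K → ESp d) ≃ₗ[ℝ] (Fin K → ESp d))
    (hmeas : KacMeas d S T)
    (h1 : KacH1 d M S T) (h2 : KacH2 d M S b T) (h3 : KacH3 d M S b T)
    (β : ℕ → ℝ) (hβ : ∀ K, 0 ≤ β K) (hβ1 : ∑ K ∈ Finset.Icc 1 M, β K = 1)
    (N : ℕ) (hNM : M ≤ N)
    (f₀ : (Fin N → ESp d) → ℝ) (hf₀ : Integrable f₀) (hsym : SymFun f₀)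
    (s : ℕ) (hs1 : 1 ≤ s) (hsN : s ≤ N) (t : ℝ) :
    HasL1DerivAt volume (fun τ => margOf N s (masterSol b T M β N f₀ τ))
      (fun V => ∑ k ∈ Finset.range M,
        bbgkyC b T M β N s k (margOf N (s + k) (masterSol b T M β N f₀ t)) V) t := by
  obtain ⟨m, rfl⟩ := Nat.exists_eq_add_of_le hsN
  obtain ⟨hInt, hderiv⟩ := (isL1Op_masterGen (b := b) hmeas h1 β (s + m)).hasL1DerivAt_expSeries
    isL1Op_margOf hf₀ (u := masterSol b T M β (s + m) f₀) (fun _ _ => rfl) t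
  exact hderiv _ (margOf_masterGen_eq_sum_bbgkyC hmeas h1 h3 β hInt
    (symFun_masterSol M β (s + m) hsym t))
end
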